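/- Let I_1 = B(x_{a_1}x_{b_1}, x_{c_1}x_{d_1}) and I_2 = B(x_{a_2}x_{b_2}, x_{c_2}x_{d_2}) be strongly stable ideals in S = K[x_1, …, x_n], where c_i < a_i ≤ b_i < d_i for i = 1, 2 and d_1 ≤ d_2, and let G = G₁ ∪ G₂ ∪ G₃ be the collection of marked binomials G₁ = { T_u T_v − T_{u'} T_{v'} : u·v = u'·v', u, v ≻_rlex v' }, G₂ = { Z_u Z_v − Z_{u'} Z_{v'} : u·v = u'·v', u, v ≻_mrlex v' }, G₃ = { T_u Z_v − T_{u'} Z_{v'} : u·v = u'·v', v ≻_mrlex v' }, marked at the first written terms. Then for every monomial μ ∈ K[x_1, …, x_n, t, z], the fiber graph Γ_μ(I_1, I_2) with respect to G is either empty or has a unique sink. -/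

import Mathlib

/-- A marked binomial: the difference of two monomials (given by exponent vectors),
with `head` chosen as the marked term. -/
structure MarkedBinomial (V : Type*) where
  head : V →₀ ℕ
  tail : V →₀ ℕ

/-- The polynomial associated to a marked binomial. -/
noncomputable def MarkedBinomial.toPoly {V : Type*} (K : Type*) [Field K]
    (g : MarkedBinomial V) : MvPolynomial V K :=
  MvPolynomial.monomial g.head 1 - MvPolynomial.monomial g.tail 1

/-- Transport a marked binomial along a map of variables. -/
noncomputable def MarkedBinomial.map {V W : Type*} (f : V → W) (g : MarkedBinomial V) :
    MarkedBinomial W :=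
  ⟨Finsupp.mapDomain f g.head, Finsupp.mapDomain f g.tail⟩

/-- A monomial order on the exponent vectors `V →₀ ℕ`: a strict total order, compatible
with addition, for which `1` (the zero exponent vector) is the smallest monomial. -/
structure MonomialOrd (V : Type*) where
  gt : (V →₀ ℕ) → (V →₀ ℕ) → Prop
  irrefl : ∀ m, ¬ gt m m
  trans : ∀ {m₁ m₂ m₃}, gt m₁ m₂ → gt m₂ m₃ → gt m₁ m₃
  total : ∀ m₁ m₂, m₁ ≠ m₂ → gt m₁ m₂ ∨ gt m₂ m₁
  add_right : ∀ {m₁ m₂} (m₃), gt m₁ m₂ → gt (m₁ + m₃) (m₂ + m₃)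
  gt_zero : ∀ m, m ≠ 0 → gt m 0

/-- `m` is the initial (leading) exponent of `f` with respect to the strict order `gt`. -/
def IsInitialTerm {V K : Type*} [Field K] (gt : (V →₀ ℕ) → (V →₀ ℕ) → Prop)
    (f : MvPolynomial V K) (m : V →₀ ℕ) : Prop :=
  m ∈ f.support ∧ ∀ m' ∈ f.support, m' ≠ m → gt m m'

/-- A set `G` of marked binomials is a Gröbner basis of the ideal `J` with respect to the
order `gt`, with the marked terms as initial terms: `G ⊆ J`, each marked term is the
initial term of its binomial, and the marked terms generate the initial ideal of `J`. -/
def IsMarkedGB {V K : Type*} [Field K] (gt : (V →₀ ℕ) → (V →₀ ℕ) → Prop)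
    (G : Set (MarkedBinomial V)) (J : Ideal (MvPolynomial V K)) : Prop :=
  (∀ g ∈ G, g.toPoly K ∈ J) ∧ (∀ g ∈ G, gt g.head g.tail) ∧
    Ideal.span ((fun g => (MvPolynomial.monomial g.head (1 : K) : MvPolynomial V K)) '' G) =
      Ideal.span {p : MvPolynomial V K |
        ∃ f ∈ J, f ≠ 0 ∧ ∃ m, IsInitialTerm gt f m ∧ p = MvPolynomial.monomial m (1 : K)}

/-- One-step reduction of a monomial (exponent vector) with respect to a collection of
marked binomials: replace an occurrence of a marked term by the corresponding tail. -/
def Reduces {V : Type*} (G : Set (MarkedBinomial V)) (m m' : V →₀ ℕ) : Prop :=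
  ∃ g ∈ G, g.head ≤ m ∧ m' = m - g.head + g.tail

/-- One-step reduction of a polynomial with respect to a collection of marked binomials. -/
noncomputable def PolyReduces {V K : Type*} [Field K] (G : Set (MarkedBinomial V))
    (f f' : MvPolynomial V K) : Prop :=
  ∃ g ∈ G, ∃ m ∈ f.support, g.head ≤ m ∧
    f' = f - MvPolynomial.monomial (m - g.head) (MvPolynomial.coeff m f) * g.toPoly K

/-- The image monomial (in the `W`-variables) of a monomial `T` in the `V`-variables under
the monomial map sending the variable `v` to the monomial with exponent vector `u v`. -/
noncomputable def fiberMap {V W : Type*} (u : V → (W →₀ ℕ)) (T : V →₀ ℕ) : W →₀ ℕ :=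
  T.sum fun v e => e • u v

/-- `T` is a sink of the fiber graph over the multidegree `μ` (with respect to the
marked binomials `G` and the monomial map determined by `u`): it lies in the fiber and
has no outgoing edge inside the fiber. -/
noncomputable def IsFiberSink {V W : Type*} (G : Set (MarkedBinomial V)) (u : V → (W →₀ ℕ))
    (μ : W →₀ ℕ) (T : V →₀ ℕ) : Prop :=
  fiberMap u T = μ ∧ ∀ T', Reduces G T T' → fiberMap u T' ≠ μ

/-- `I` is a monomial ideal. -/
def IsMonomialIdeal {n : ℕ} {K : Type*} [Field K] (I : Ideal (MvPolynomial (Fin n) K)) : Prop :=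
  ∃ M : Set (Fin n →₀ ℕ), I = Ideal.span ((fun m => (MvPolynomial.monomial m (1 : K))) '' M)

/-- `I` is a strongly stable (Borel) ideal: a monomial ideal such that whenever `x_i`
divides a monomial `m ∈ I` and `j < i`, also `x_j · m / x_i ∈ I`. -/
def StronglyStable {n : ℕ} {K : Type*} [Field K] (I : Ideal (MvPolynomial (Fin n) K)) : Prop :=
  IsMonomialIdeal I ∧ ∀ m : Fin n →₀ ℕ, MvPolynomial.monomial m (1 : K) ∈ I →
    ∀ i j : Fin n, j < i → m i ≠ 0 →
      MvPolynomial.monomial (m - Finsupp.single i 1 + Finsupp.single j 1) (1 : K) ∈ I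

/-- The smallest strongly stable ideal containing the given monomials. -/
noncomputable def smallestStronglyStable {n : ℕ} (K : Type*) [Field K]
    (Ms : Set (Fin n →₀ ℕ)) : Ideal (MvPolynomial (Fin n) K) :=
  sInf {I | StronglyStable I ∧ ∀ m ∈ Ms, MvPolynomial.monomial m (1 : K) ∈ I}

/-- The minimal monomial generators of an ideal generated in the single degree `d`:
the degree-`d` monomials lying in `I`. -/
def MinGens {n : ℕ} {K : Type*} [Field K] (I : Ideal (MvPolynomial (Fin n) K)) (d : ℕ) :
    Set (Fin n →₀ ℕ) :=
  {m | (m.sum fun _ e => e) = d ∧ MvPolynomial.monomial m (1 : K) ∈ I}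

/-- `u ≻_rlex v` (reverse lexicographic, `x_1 > … > x_n`, for exponent vectors of equal
total degree): at the largest index where they differ, `u` has the smaller exponent. -/
def RlexGt {n : ℕ} (u v : Fin n →₀ ℕ) : Prop :=
  ∃ k : Fin n, u k < v k ∧ ∀ l : Fin n, k < l → u l = v l

/-- The (degree-)reverse lexicographic order on monomials of `K[V]` induced by the strict
variable order `vgt` (where `vgt k l` means the variable `k` is greater than `l`). -/
def VarRevlexGt {V : Type*} (vgt : V → V → Prop) (m m' : V →₀ ℕ) : Prop :=
  (m.sum fun _ e => e) > (m'.sum fun _ e => e) ∨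
    ((m.sum fun _ e => e) = (m'.sum fun _ e => e) ∧
      ∃ k, m k < m' k ∧ ∀ l, vgt k l → m l = m' l)

/-- The minimal monomial generators of the strongly stable ideal `B(x_a x_b)` (`a ≤ b`):
the monomials `x_i x_j` with `i ≤ j`, `i ≤ a`, `j ≤ b`. -/
def BM {n : ℕ} (a b : Fin n) : Set (Fin n →₀ ℕ) :=
  {m | ∃ i j : Fin n, i ≤ j ∧ i ≤ a ∧ j ≤ b ∧ m = Finsupp.single i 1 + Finsupp.single j 1}

/-- The minimal monomial generators of `B(x_c x_d)` not in `B(x_a x_b)` (for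
`c < a ≤ b < d`): the monomials `x_i x_j` with `i ≤ c` and `b < j ≤ d`. -/
def BN {n : ℕ} (b c d : Fin n) : Set (Fin n →₀ ℕ) :=
  {m | ∃ i j : Fin n, i ≤ c ∧ b < j ∧ j ≤ d ∧ m = Finsupp.single i 1 + Finsupp.single j 1}

/-- `u ≻_mrlex v`: every element of `B_N` is greater than every element of `B_M`, and
within `B_M` (resp. `B_N`) the order agrees with `≻_rlex`. -/
def MrlexGt {n : ℕ} (a b c d : Fin n) (u v : Fin n →₀ ℕ) : Prop :=
  (u ∈ BN b c d ∧ v ∈ BM a b) ∨ (u ∈ BM a b ∧ v ∈ BM a b ∧ RlexGt u v) ∨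
    (u ∈ BN b c d ∧ v ∈ BN b c d ∧ RlexGt u v)

/-- The collection `G₁` of marked binomials `T_u T_v − T_{u'} T_{v'}` with `u v = u' v'`
and `u, v ≻_rlex v'`, marked at `T_u T_v`. -/
def G1 {n : ℕ} (a b c d : Fin n) : Set (MarkedBinomial ↥(BM a b ∪ BN b c d)) :=
  {g | ∃ u v u' v' : ↥(BM a b ∪ BN b c d),
    (u : Fin n →₀ ℕ) + (v : Fin n →₀ ℕ) = (u' : Fin n →₀ ℕ) + (v' : Fin n →₀ ℕ) ∧
    RlexGt (u : Fin n →₀ ℕ) (v' : Fin n →₀ ℕ) ∧ RlexGt (v : Fin n →₀ ℕ) (v' : Fin n →₀ ℕ) ∧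
    g.head = Finsupp.single u 1 + Finsupp.single v 1 ∧
    g.tail = Finsupp.single u' 1 + Finsupp.single v' 1}

/-- The collection `G₂` of marked binomials `T_u T_v − T_{u'} T_{v'}` with `u v = u' v'`
and `u, v ≻_mrlex v'`, marked at `T_u T_v`. -/
def G2 {n : ℕ} (a b c d : Fin n) : Set (MarkedBinomial ↥(BM a b ∪ BN b c d)) :=
  {g | ∃ u v u' v' : ↥(BM a b ∪ BN b c d),
    (u : Fin n →₀ ℕ) + (v : Fin n →₀ ℕ) = (u' : Fin n →₀ ℕ) + (v' : Fin n →₀ ℕ) ∧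
    MrlexGt a b c d (u : Fin n →₀ ℕ) (v' : Fin n →₀ ℕ) ∧
    MrlexGt a b c d (v : Fin n →₀ ℕ) (v' : Fin n →₀ ℕ) ∧
    g.head = Finsupp.single u 1 + Finsupp.single v 1 ∧
    g.tail = Finsupp.single u' 1 + Finsupp.single v' 1}

/-- `w` is the smallest (with respect to the variable order induced by `≻_rlex`) variable
factor of the monomial `T` whose underlying monomial lies in `S`. -/
def IsLeastFactorIn {n : ℕ} {V : Set (Fin n →₀ ℕ)} (S : Set (Fin n →₀ ℕ))
    (T : ↥V →₀ ℕ) (w : ↥V) : Prop :=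
  w ∈ T.support ∧ (w : Fin n →₀ ℕ) ∈ S ∧
    ∀ v ∈ T.support, (v : Fin n →₀ ℕ) ∈ S →
      v = w ∨ RlexGt (v : Fin n →₀ ℕ) (w : Fin n →₀ ℕ)

/-- `m` is the `≻_rlex`-smallest element of `S` dividing `μ`. -/
def IsLeastDivisorIn {n : ℕ} (S : Set (Fin n →₀ ℕ)) (μ m : Fin n →₀ ℕ) : Prop :=
  m ∈ S ∧ m ≤ μ ∧ ∀ m' ∈ S, m' ≤ μ → m' = m ∨ RlexGt m' m

/-- The head and tail variable order on `T`-variables (indexed by `S₁`) and `Z`-variables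
(indexed by `B_{M₂} ∪ B_{N₂}`): `T_u > T_v ⟺ u ≻_rlex v`, every `T`-variable is greater
than every `Z`-variable, and `Z_u > Z_v ⟺ u ≻_mrlex v`. -/
def HTVarGt {n : ℕ} (a₂ b₂ c₂ d₂ : Fin n) (S₁ S₂ : Set (Fin n →₀ ℕ)) :
    (↥S₁ ⊕ ↥S₂) → (↥S₁ ⊕ ↥S₂) → Prop :=
  fun w w' =>
    match w, w' with
    | Sum.inl u, Sum.inl v => RlexGt (u : Fin n →₀ ℕ) (v : Fin n →₀ ℕ)
    | Sum.inl _, Sum.inr _ => True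
    | Sum.inr _, Sum.inl _ => False
    | Sum.inr u, Sum.inr v => MrlexGt a₂ b₂ c₂ d₂ (u : Fin n →₀ ℕ) (v : Fin n →₀ ℕ)

/-- The collection `G₃` of marked binomials `T_u Z_v − T_{u'} Z_{v'}` with
`u v = u' v'` and `v ≻_mrlex v'`, marked at `T_u Z_v`. -/
def G3TZ {n : ℕ} (a₁ b₁ c₁ d₁ a₂ b₂ c₂ d₂ : Fin n) :
    Set (MarkedBinomial (↥(BM a₁ b₁ ∪ BN b₁ c₁ d₁) ⊕ ↥(BM a₂ b₂ ∪ BN b₂ c₂ d₂))) :=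
  {g | ∃ (u u' : ↥(BM a₁ b₁ ∪ BN b₁ c₁ d₁)) (v v' : ↥(BM a₂ b₂ ∪ BN b₂ c₂ d₂)),
    (u : Fin n →₀ ℕ) + (v : Fin n →₀ ℕ) = (u' : Fin n →₀ ℕ) + (v' : Fin n →₀ ℕ) ∧
    MrlexGt a₂ b₂ c₂ d₂ (v : Fin n →₀ ℕ) (v' : Fin n →₀ ℕ) ∧
    g.head = Finsupp.single (Sum.inl u) 1 + Finsupp.single (Sum.inr v) 1 ∧
    g.tail = Finsupp.single (Sum.inl u') 1 + Finsupp.single (Sum.inr v') 1}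

/-- The full marked collection `G = G₁ ∪ G₂ ∪ G₃` for the pair of strongly stable ideals
`I₁ = B(x_{a₁}x_{b₁}, x_{c₁}x_{d₁})` and `I₂ = B(x_{a₂}x_{b₂}, x_{c₂}x_{d₂})`, with `G₁`
in the `T`-variables, `G₂` in the `Z`-variables, and `G₃` mixed. -/
noncomputable def GHT {n : ℕ} (a₁ b₁ c₁ d₁ a₂ b₂ c₂ d₂ : Fin n) :
    Set (MarkedBinomial (↥(BM a₁ b₁ ∪ BN b₁ c₁ d₁) ⊕ ↥(BM a₂ b₂ ∪ BN b₂ c₂ d₂))) :=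
  (MarkedBinomial.map Sum.inl '' G1 a₁ b₁ c₁ d₁) ∪
    (MarkedBinomial.map Sum.inr '' G2 a₂ b₂ c₂ d₂) ∪
    G3TZ a₁ b₁ c₁ d₁ a₂ b₂ c₂ d₂

/-- The monomial map sending `T_u ↦ u·t` and `Z_v ↦ v·z`, on the level of exponent
vectors, with `t, z` the two extra variables `Sum.inr 0`, `Sum.inr 1`. -/
noncomputable def TZexp {n : ℕ} (S₁ S₂ : Set (Fin n →₀ ℕ)) :
    (↥S₁ ⊕ ↥S₂) → ((Fin n ⊕ Fin 2) →₀ ℕ) :=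
  Sum.elim
    (fun u => Finsupp.mapDomain Sum.inl (u : Fin n →₀ ℕ) +
      Finsupp.single (Sum.inr 0) 1)
    (fun v => Finsupp.mapDomain Sum.inl (v : Fin n →₀ ℕ) +
      Finsupp.single (Sum.inr 1) 1)

/-- The quadratic monomial `x_i x_j`. -/
noncomputable def quad {n : ℕ} (i j : Fin n) : Fin n →₀ ℕ :=
  Finsupp.single i 1 + Finsupp.single j 1

/-- `x_i x_j ≻_rlex x_k x_l`, on indices. -/
def PairRlex (i j k l : ℕ) : Prop :=
  max i j < max k l ∨ max i j = max k l ∧ min i j < min k l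

/-- `x_i x_j` is a generator of `B(x_a x_b, x_c x_d)`, on indices. -/
def PairMem (a b c d i j : ℕ) : Prop :=
  min i j ≤ a ∧ max i j ≤ b ∨ min i j ≤ c ∧ b < max i j ∧ max i j ≤ d

/-- `x_i x_j ≻_mrlex x_k x_l` for generators of `B(x_a x_b, x_c x_d)`, on indices. -/
def PairMrlex (b i j k l : ℕ) : Prop :=
  b < max i j ∧ max k l ≤ b ∨ (b < max i j ↔ b < max k l) ∧ PairRlex i j k l

theorem quad_comm {n : ℕ} (i j : Fin n) : quad i j = quad j i := add_comm _ _

theorem quad_apply {n : ℕ} (i j m : Fin n) :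
    quad i j m = (if (i : ℕ) = m then 1 else 0) + (if (j : ℕ) = m then 1 else 0) := by
  simp [quad, Finsupp.single_apply, Fin.ext_iff]

theorem rlexGt_quad_of_pairRlex {n : ℕ} {i j k l : Fin n} (h : PairRlex i j k l) :
    RlexGt (quad i j) (quad k l) := by
  wlog hij : i ≤ j generalizing i j
  · rw [quad_comm]
    exact this (by unfold PairRlex at *; omega) (le_of_not_ge hij)
  wlog hkl : k ≤ l generalizing k l
  · rw [quad_comm k]
    exact this (by unfold PairRlex at *; omega) (le_of_not_ge hkl)
  simp only [Fin.le_def] at hij hkl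
  rcases lt_or_ge (j : ℕ) l with h' | h'
  · refine ⟨l, ?_, fun m hm => ?_⟩
    · simp only [quad_apply]
      split_ifs <;> omega
    · simp only [quad_apply, Fin.lt_def] at *
      split_ifs <;> omega
  · unfold PairRlex at h
    refine ⟨k, ?_, fun m hm => ?_⟩
    · simp only [quad_apply]
      split_ifs <;> omega
    · simp only [quad_apply, Fin.lt_def] at *
      split_ifs <;> omega

theorem RlexGt.asymm {n : ℕ} {u v : Fin n →₀ ℕ} (h : RlexGt u v) : ¬ RlexGt v u := by
  obtain ⟨k, hk, hk'⟩ := h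
  rintro ⟨m, hm, hm'⟩
  rcases lt_trichotomy k m with h | rfl | h
  · have := hk' m h; omega
  · omega
  · have := hm' k h; omega

theorem quad_eq_quad_or {n : ℕ} (i j k l : Fin n) :
    quad i j = quad k l ∨ PairRlex i j k l ∨ PairRlex k l i j := by
  by_cases h : (i : ℕ) = k ∧ (j : ℕ) = l ∨ (i : ℕ) = l ∧ (j : ℕ) = k
  · left
    rcases h with ⟨h, h'⟩ | ⟨h, h'⟩
    · rw [Fin.ext h, Fin.ext h']
    · rw [Fin.ext h, Fin.ext h', quad_comm]
  · unfold PairRlex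
    omega

theorem rlexGt_quad_iff {n : ℕ} {i j k l : Fin n} :
    RlexGt (quad i j) (quad k l) ↔ PairRlex i j k l := by
  refine ⟨fun h => ?_, rlexGt_quad_of_pairRlex⟩
  rcases quad_eq_quad_or i j k l with h' | h' | h'
  · rw [h'] at h
    exact absurd h h.asymm
  · exact h'
  · exact absurd h (rlexGt_quad_of_pairRlex h').asymm

theorem quad_inj {n : ℕ} {i j k l : Fin n} (h : quad i j = quad k l) :
    min (i : ℕ) j = min (k : ℕ) l ∧ max (i : ℕ) j = max (k : ℕ) l := by
  by_contra hne
  have : PairRlex i j k l ∨ PairRlex k l i j := by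
    unfold PairRlex
    omega
  rcases this with h' | h'
  · have := rlexGt_quad_of_pairRlex h'
    rw [h] at this
    exact this.asymm this
  · have := rlexGt_quad_of_pairRlex h'
    rw [h] at this
    exact this.asymm this

theorem quad_mem_BM {n : ℕ} {a b i j : Fin n} (hab : a ≤ b) :
    quad i j ∈ BM a b ↔ min (i : ℕ) j ≤ a ∧ max (i : ℕ) j ≤ b := by
  constructor
  · rintro ⟨k, l, h1, h2, h3, h⟩
    have := quad_inj (h : quad i j = quad k l)
    simp only [Fin.le_def] at *
    omega
  · intro h
    rcases le_total i j with h' | h'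
    · exact ⟨i, j, h', by simp only [Fin.le_def] at *; omega,
        by simp only [Fin.le_def] at *; omega, rfl⟩
    · exact ⟨j, i, h', by simp only [Fin.le_def] at *; omega,
        by simp only [Fin.le_def] at *; omega, quad_comm _ _⟩

theorem quad_mem_BN {n : ℕ} {b c d i j : Fin n} (hcb : c < b) :
    quad i j ∈ BN b c d ↔
      min (i : ℕ) j ≤ c ∧ (b : ℕ) < max (i : ℕ) j ∧ max (i : ℕ) j ≤ d := by
  constructor
  · rintro ⟨k, l, h1, h2, h3, h⟩
    have := quad_inj (h : quad i j = quad k l)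
    simp only [Fin.le_def, Fin.lt_def] at *
    omega
  · intro h
    rcases le_total i j with h' | h'
    · exact ⟨i, j, by simp only [Fin.le_def] at *; omega,
        by simp only [Fin.le_def, Fin.lt_def] at *; omega,
        by simp only [Fin.le_def] at *; omega, rfl⟩
    · exact ⟨j, i, by simp only [Fin.le_def] at *; omega,
        by simp only [Fin.le_def, Fin.lt_def] at *; omega,
        by simp only [Fin.le_def] at *; omega, quad_comm _ _⟩

theorem quad_mem_iff {n : ℕ} {a b c d i j : Fin n} (hca : c < a) (hab : a ≤ b) :
    quad i j ∈ BM a b ∪ BN b c d ↔ PairMem a b c d i j := by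
  rw [Set.mem_union, quad_mem_BM hab, quad_mem_BN (hca.trans_le hab)]
  rfl

theorem exists_eq_quad {n : ℕ} {a b c d : Fin n} {m : Fin n →₀ ℕ} (hm : m ∈ BM a b ∪ BN b c d) :
    ∃ i j, m = quad i j := by
  rcases hm with ⟨i, j, _, _, _, h⟩ | ⟨i, j, _, _, _, h⟩ <;> exact ⟨i, j, h⟩

theorem mrlexGt_quad_iff {n : ℕ} {a b c d i j k l : Fin n} (hca : c < a) (hab : a ≤ b)
    (h : PairMem a b c d i j) (h' : PairMem a b c d k l) :
    MrlexGt a b c d (quad i j) (quad k l) ↔ PairMrlex b i j k l := by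
  have hcb := hca.trans_le hab
  rw [MrlexGt, quad_mem_BN hcb, quad_mem_BN hcb, quad_mem_BM hab, quad_mem_BM hab,
    rlexGt_quad_iff]
  unfold PairMem PairMrlex at *
  simp only [← not_le] at *
  by_cases h1 : max (i : ℕ) j ≤ b <;> by_cases h2 : max (k : ℕ) l ≤ b <;>
    simp only [h1, h2, not_true, not_false_eq_true, true_and, and_true, false_and, and_false,
      or_false, false_or] at h h' ⊢ <;>
    simp [h, h']

section FiberMap

variable {V W : Type*}

theorem fiberMap_add (u : V → (W →₀ ℕ)) (S T : V →₀ ℕ) :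
    fiberMap u (S + T) = fiberMap u S + fiberMap u T :=
  Finsupp.sum_add_index' (fun _ => zero_smul _ _) (fun _ _ _ => add_smul _ _ _)

theorem fiberMap_single (u : V → (W →₀ ℕ)) (v : V) :
    fiberMap u (Finsupp.single v 1) = u v := by
  simp [fiberMap]

theorem map_fiberMap {M : Type*} [AddCommMonoid M] (u : V → (W →₀ ℕ)) (L : (W →₀ ℕ) →+ M)
    (T : V →₀ ℕ) : L (fiberMap u T) = T.sum fun v e => e • L (u v) := by
  simp [fiberMap, Finsupp.sum, map_sum, map_nsmul]

theorem fiberMap_apply (u : V → (W →₀ ℕ)) (T : V →₀ ℕ) (s : W) :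
    fiberMap u T s = T.sum fun v e => e * u v s := by
  simp [fiberMap, Finsupp.sum, Finsupp.finsetSum_apply]

/-- No marked term of `G` divides `T`. -/
def IsIrred (G : Set (MarkedBinomial V)) (T : V →₀ ℕ) : Prop :=
  ∀ g ∈ G, ¬ g.head ≤ T

theorem IsIrred.mono {G : Set (MarkedBinomial V)} {S T : V →₀ ℕ} (hT : IsIrred G T)
    (h : S ≤ T) : IsIrred G S :=
  fun g hg hgS => hT g hg (hgS.trans h)

theorem fiberMap_of_reduces {G : Set (MarkedBinomial V)} {u : V → (W →₀ ℕ)}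
    (hG : ∀ g ∈ G, fiberMap u g.head = fiberMap u g.tail) {T T' : V →₀ ℕ}
    (h : Reduces G T T') : fiberMap u T' = fiberMap u T := by
  obtain ⟨g, hg, hle, rfl⟩ := h
  conv_rhs => rw [← tsub_add_cancel_of_le hle]
  rw [fiberMap_add, fiberMap_add, hG g hg]

theorem isFiberSink_iff {G : Set (MarkedBinomial V)} {u : V → (W →₀ ℕ)}
    (hG : ∀ g ∈ G, fiberMap u g.head = fiberMap u g.tail) {μ : W →₀ ℕ} {T : V →₀ ℕ} :
    IsFiberSink G u μ T ↔ fiberMap u T = μ ∧ IsIrred G T := by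
  refine and_congr_right fun hT => ⟨fun h g hg hle => ?_, fun h T' hT' => ?_⟩
  · have hr : Reduces G T (T - g.head + g.tail) := ⟨g, hg, hle, rfl⟩
    exact h _ hr ((fiberMap_of_reduces hG hr).trans hT)
  · obtain ⟨g, hg, hle, -⟩ := hT'
    exact absurd hle (h g hg)

/-- If the tail of each binomial outweighs its marked term, then a bounded weight forces every
fiber to contain an irreducible monomial. -/
theorem exists_isIrred {G : Set (MarkedBinomial V)} {u : V → (W →₀ ℕ)}
    (hG : ∀ g ∈ G, fiberMap u g.head = fiberMap u g.tail) (φ : (V →₀ ℕ) →+ ℕ)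
    (hφ : ∀ g ∈ G, φ g.head < φ g.tail) (T : V →₀ ℕ) (B : ℕ)
    (hB : ∀ T', fiberMap u T' = fiberMap u T → φ T' ≤ B) :
    ∃ T', fiberMap u T' = fiberMap u T ∧ IsIrred G T' := by
  by_cases h : IsIrred G T
  · exact ⟨T, rfl, h⟩
  · simp only [IsIrred, not_forall, not_not] at h
    obtain ⟨g, hg, hle⟩ := h
    have hr : Reduces G T (T - g.head + g.tail) := ⟨g, hg, hle, rfl⟩
    have hfib := fiberMap_of_reduces hG hr
    have hlt : φ T < φ (T - g.head + g.tail) := by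
      conv_lhs => rw [← tsub_add_cancel_of_le hle]
      rw [map_add, map_add]
      have := hφ g hg
      omega
    have hle' := hB _ hfib
    obtain ⟨T', hT', hI⟩ := exists_isIrred hG φ hφ (T - g.head + g.tail) B
      (fun T' hT' => hB T' (hT'.trans hfib))
    exact ⟨T', hT'.trans hfib, hI⟩
termination_by B - φ T
decreasing_by
  have := map_add φ (T - g.head) g.tail
  omega

end FiberMap

section

variable {n : ℕ} {S₁ S₂ : Set (Fin n →₀ ℕ)}

theorem TZexp_inl_inl (u : S₁) (i : Fin n) :
    TZexp S₁ S₂ (Sum.inl u) (Sum.inl i) = (u : Fin n →₀ ℕ) i := by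
  simp [TZexp, Finsupp.mapDomain_apply Sum.inl_injective]

theorem TZexp_inr_inl (u : S₂) (i : Fin n) :
    TZexp S₁ S₂ (Sum.inr u) (Sum.inl i) = (u : Fin n →₀ ℕ) i := by
  simp [TZexp, Finsupp.mapDomain_apply Sum.inl_injective]

theorem TZexp_inl_inr (u : S₁) (k : Fin 2) :
    TZexp S₁ S₂ (Sum.inl u) (Sum.inr k) = if k = 0 then 1 else 0 := by
  simp [TZexp, Finsupp.mapDomain_of_notMem_range, Finsupp.single_apply, eq_comm]

theorem TZexp_inr_inr (u : S₂) (k : Fin 2) :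
    TZexp S₁ S₂ (Sum.inr u) (Sum.inr k) = if k = 1 then 1 else 0 := by
  simp [TZexp, Finsupp.mapDomain_of_notMem_range, Finsupp.single_apply, eq_comm]

theorem TZexp_inl_add_inl {u v u' v' : S₁}
    (h : (u : Fin n →₀ ℕ) + v = (u' : Fin n →₀ ℕ) + v') :
    TZexp S₁ S₂ (Sum.inl u) + TZexp S₁ S₂ (Sum.inl v) =
      TZexp S₁ S₂ (Sum.inl u') + TZexp S₁ S₂ (Sum.inl v') := by
  ext (i | k)
  · simpa only [Finsupp.add_apply, TZexp_inl_inl] using DFunLike.congr_fun h i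
  · simp only [Finsupp.add_apply, TZexp_inl_inr]

theorem TZexp_inr_add_inr {u v u' v' : S₂}
    (h : (u : Fin n →₀ ℕ) + v = (u' : Fin n →₀ ℕ) + v') :
    TZexp S₁ S₂ (Sum.inr u) + TZexp S₁ S₂ (Sum.inr v) =
      TZexp S₁ S₂ (Sum.inr u') + TZexp S₁ S₂ (Sum.inr v') := by
  ext (i | k)
  · simpa only [Finsupp.add_apply, TZexp_inr_inl] using DFunLike.congr_fun h i
  · simp only [Finsupp.add_apply, TZexp_inr_inr]

theorem TZexp_inl_add_inr {u u' : S₁} {v v' : S₂}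
    (h : (u : Fin n →₀ ℕ) + v = (u' : Fin n →₀ ℕ) + v') :
    TZexp S₁ S₂ (Sum.inl u) + TZexp S₁ S₂ (Sum.inr v) =
      TZexp S₁ S₂ (Sum.inl u') + TZexp S₁ S₂ (Sum.inr v') := by
  ext (i | k)
  · simpa only [Finsupp.add_apply, TZexp_inl_inl, TZexp_inr_inl] using DFunLike.congr_fun h i
  · simp only [Finsupp.add_apply, TZexp_inl_inr, TZexp_inr_inr]

end

section

variable {n : ℕ} {a₁ b₁ c₁ d₁ a₂ b₂ c₂ d₂ : Fin n}

/-- Every marked binomial of `GHT` has the form `X_u X_v - X_{u'} X_{v'}`, with `v'` smaller than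
both `u` and `v`. -/
theorem exists_of_mem_GHT {g} (hg : g ∈ GHT a₁ b₁ c₁ d₁ a₂ b₂ c₂ d₂) :
    ∃ u v u' v', g.head = Finsupp.single u 1 + Finsupp.single v 1 ∧
      g.tail = Finsupp.single u' 1 + Finsupp.single v' 1 ∧
      TZexp _ _ u + TZexp _ _ v = TZexp _ _ u' + TZexp _ _ v' ∧
      HTVarGt a₂ b₂ c₂ d₂ _ _ u v' ∧ HTVarGt a₂ b₂ c₂ d₂ _ _ v v' := by
  rcases hg with (⟨g, ⟨u, v, u', v', h, hu, hv, hh, ht⟩, rfl⟩ |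
    ⟨g, ⟨u, v, u', v', h, hu, hv, hh, ht⟩, rfl⟩) | ⟨u, u', v, v', h, hv, hh, ht⟩
  · exact ⟨.inl u, .inl v, .inl u', .inl v',
      by simp [MarkedBinomial.map, hh, Finsupp.mapDomain_add, Finsupp.mapDomain_single],
      by simp [MarkedBinomial.map, ht, Finsupp.mapDomain_add, Finsupp.mapDomain_single],
      TZexp_inl_add_inl h, hu, hv⟩
  · exact ⟨.inr u, .inr v, .inr u', .inr v',
      by simp [MarkedBinomial.map, hh, Finsupp.mapDomain_add, Finsupp.mapDomain_single],
      by simp [MarkedBinomial.map, ht, Finsupp.mapDomain_add, Finsupp.mapDomain_single],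
      TZexp_inr_add_inr h, hu, hv⟩
  · exact ⟨.inl u, .inr v, .inl u', .inr v', hh, ht, TZexp_inl_add_inr h, trivial, hv⟩

theorem fiberMap_head_eq_tail {g} (hg : g ∈ GHT a₁ b₁ c₁ d₁ a₂ b₂ c₂ d₂) :
    fiberMap (TZexp _ _) g.head = fiberMap (TZexp _ _) g.tail := by
  obtain ⟨u, v, u', v', hh, ht, h, -, -⟩ := exists_of_mem_GHT hg
  simpa only [hh, ht, fiberMap_add, fiberMap_single] using h

/-- The base-3 value of an exponent vector; on quadratic monomials it decreases along `≻_rlex`. -/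
def ternary (m : Fin n →₀ ℕ) : ℕ := ∑ i, m i * 3 ^ (i : ℕ)

theorem ternary_quad (i j : Fin n) : ternary (quad i j) = 3 ^ (i : ℕ) + 3 ^ (j : ℕ) := by
  simp [ternary, quad_apply, add_mul, Finset.sum_add_distrib, ← Fin.ext_iff]

theorem ternary_quad_lt {i j k l : Fin n} (h : PairRlex i j k l) :
    ternary (quad i j) < ternary (quad k l) := by
  wlog hij : i ≤ j generalizing i j
  · rw [quad_comm]
    exact this (by unfold PairRlex at *; omega) (le_of_not_ge hij)
  wlog hkl : k ≤ l generalizing k l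
  · rw [quad_comm k]
    exact this (by unfold PairRlex at *; omega) (le_of_not_ge hkl)
  simp only [Fin.le_def] at hij hkl
  simp only [ternary_quad]
  have key : (j : ℕ) < l ∨ (j : ℕ) = l ∧ (i : ℕ) < k := by
    unfold PairRlex at h
    omega
  rcases key with h' | ⟨h', h''⟩
  · have h1 : 3 ^ (i : ℕ) ≤ 3 ^ (j : ℕ) := Nat.pow_le_pow_right (by norm_num) hij
    have h2 : 3 ^ ((j : ℕ) + 1) ≤ 3 ^ (l : ℕ) := Nat.pow_le_pow_right (by norm_num) h'
    have h3 : 0 < 3 ^ (j : ℕ) := by positivity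
    have h4 : 0 < 3 ^ (k : ℕ) := by positivity
    rw [pow_succ] at h2
    omega
  · have := Nat.pow_lt_pow_right (a := 3) (by norm_num) h''
    rw [h']
    omega

theorem ternary_quad_lt_pow (i j : Fin n) : ternary (quad i j) < 3 ^ n := by
  rw [ternary_quad]
  have h1 : 3 ^ ((i : ℕ) + 1) ≤ 3 ^ n := Nat.pow_le_pow_right (by norm_num) i.2
  have h2 : 3 ^ ((j : ℕ) + 1) ≤ 3 ^ n := Nat.pow_le_pow_right (by norm_num) j.2
  have : 0 < 3 ^ n := by positivity
  rw [pow_succ] at h1 h2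
  omega

open Classical in
/-- A rank of the variables, increasing as the variables decrease. -/
noncomputable def tzRank (b c d : Fin n) (S₁ S₂ : Set (Fin n →₀ ℕ)) : S₁ ⊕ S₂ → ℕ :=
  Sum.elim (fun u => ternary (u : Fin n →₀ ℕ))
    (fun v => ternary (v : Fin n →₀ ℕ) + if (v : Fin n →₀ ℕ) ∈ BN b c d then 3 ^ n else 2 * 3 ^ n)

theorem tzRank_lt (hca : c₂ < a₂) (hab : a₂ ≤ b₂)
    {x y : ↥(BM a₁ b₁ ∪ BN b₁ c₁ d₁) ⊕ ↥(BM a₂ b₂ ∪ BN b₂ c₂ d₂)}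
    (h : HTVarGt a₂ b₂ c₂ d₂ _ _ x y) :
    tzRank b₂ c₂ d₂ _ _ x < tzRank b₂ c₂ d₂ _ _ y := by
  have hcb := hca.trans_le hab
  rcases x with ⟨x, hx⟩ | ⟨x, hx⟩ <;> rcases y with ⟨y, hy⟩ | ⟨y, hy⟩
  all_goals
    obtain ⟨i, j, rfl⟩ := exists_eq_quad hx
    obtain ⟨k, l, rfl⟩ := exists_eq_quad hy
  · exact ternary_quad_lt (rlexGt_quad_iff.1 h)
  · have := ternary_quad_lt_pow i j
    simp only [tzRank, Sum.elim_inl, Sum.elim_inr]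
    split_ifs <;> omega
  · exact h.elim
  · have h1 := ternary_quad_lt_pow i j
    have hM := (mrlexGt_quad_iff hca hab ((quad_mem_iff hca hab).1 hx)
      ((quad_mem_iff hca hab).1 hy)).1 h
    have hx' := (quad_mem_iff hca hab).1 hx
    have hy' := (quad_mem_iff hca hab).1 hy
    have hxN : quad i j ∈ BN b₂ c₂ d₂ ↔ (b₂ : ℕ) < max (i : ℕ) j := by
      rw [quad_mem_BN hcb]
      unfold PairMem at hx'
      omega
    have hyN : quad k l ∈ BN b₂ c₂ d₂ ↔ (b₂ : ℕ) < max (k : ℕ) l := by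
      rw [quad_mem_BN hcb]
      unfold PairMem at hy'
      omega
    simp only [tzRank, Sum.elim_inr, hxN, hyN]
    rcases hM with ⟨h3, h4⟩ | ⟨h3, h4⟩
    · rw [if_pos h3, if_neg h4.not_gt]
      omega
    · simp only [h3]
      exact Nat.add_lt_add_right (ternary_quad_lt h4) _

theorem HTVarGt_or (hca : c₂ < a₂) (hab : a₂ ≤ b₂)
    {x y : ↥(BM a₁ b₁ ∪ BN b₁ c₁ d₁) ⊕ ↥(BM a₂ b₂ ∪ BN b₂ c₂ d₂)} (hne : x ≠ y) :
    HTVarGt a₂ b₂ c₂ d₂ _ _ x y ∨ HTVarGt a₂ b₂ c₂ d₂ _ _ y x := by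
  rcases x with ⟨x, hx⟩ | ⟨x, hx⟩ <;> rcases y with ⟨y, hy⟩ | ⟨y, hy⟩
  all_goals
    obtain ⟨i, j, rfl⟩ := exists_eq_quad hx
    obtain ⟨k, l, rfl⟩ := exists_eq_quad hy
  · have := quad_eq_quad_or i j k l
    simpa [HTVarGt, rlexGt_quad_iff, show quad i j ≠ quad k l by simpa using hne] using this
  · exact .inl trivial
  · exact .inr trivial
  · have hx' := (quad_mem_iff hca hab).1 hx
    have hy' := (quad_mem_iff hca hab).1 hy
    have : PairRlex i j k l ∨ PairRlex k l i j := by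
      simpa [show quad i j ≠ quad k l by simpa using hne] using quad_eq_quad_or i j k l
    simp only [HTVarGt, mrlexGt_quad_iff hca hab hx' hy', mrlexGt_quad_iff hca hab hy' hx']
    unfold PairMrlex
    rcases this with h | h
    · by_cases h1 : (b₂ : ℕ) < max (i : ℕ) j <;> by_cases h2 : (b₂ : ℕ) < max (k : ℕ) l <;>
        simp [h, h1, h2] <;> omega
    · by_cases h1 : (b₂ : ℕ) < max (i : ℕ) j <;> by_cases h2 : (b₂ : ℕ) < max (k : ℕ) l <;>
        simp [h, h1, h2] <;> omega

theorem exists_isIrred_GHT (hca : c₂ < a₂) (hab : a₂ ≤ b₂)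
    (T : ↥(BM a₁ b₁ ∪ BN b₁ c₁ d₁) ⊕ ↥(BM a₂ b₂ ∪ BN b₂ c₂ d₂) →₀ ℕ) :
    ∃ T', fiberMap (TZexp _ _) T' = fiberMap (TZexp _ _) T ∧
      IsIrred (GHT a₁ b₁ c₁ d₁ a₂ b₂ c₂ d₂) T' := by
  set ρ := tzRank b₂ c₂ d₂ (BM a₁ b₁ ∪ BN b₁ c₁ d₁) (BM a₂ b₂ ∪ BN b₂ c₂ d₂)
  have hρ : ∀ x, ρ x ≤ 3 ^ n + 2 * 3 ^ n := by
    rintro (⟨x, hx⟩ | ⟨x, hx⟩) <;> obtain ⟨i, j, rfl⟩ := exists_eq_quad hx <;>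
      have := ternary_quad_lt_pow i j <;>
      simp only [ρ, tzRank, Sum.elim_inl, Sum.elim_inr]
    · omega
    · split_ifs <;> omega
  have hdeg : ∀ T' : ↥(BM a₁ b₁ ∪ BN b₁ c₁ d₁) ⊕ ↥(BM a₂ b₂ ∪ BN b₂ c₂ d₂) →₀ ℕ,
      T'.sum (fun _ e => e) = fiberMap (TZexp _ _) T' (Sum.inr 0) +
        fiberMap (TZexp _ _) T' (Sum.inr 1) := by
    intro T'
    rw [fiberMap_apply, fiberMap_apply, ← Finsupp.sum_add]
    refine Finsupp.sum_congr fun x _ => ?_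
    rcases x with x | x <;> simp [TZexp_inl_inr, TZexp_inr_inr]
  refine exists_isIrred (fun g hg => fiberMap_head_eq_tail hg)
    (Finsupp.liftAddHom fun x => AddMonoidHom.mulRight (3 ^ ρ x)) (fun g hg => ?_) T
    (T.sum (fun _ e => e) * 3 ^ (3 ^ n + 2 * 3 ^ n)) (fun T' hT' => ?_)
  · obtain ⟨u, v, u', v', hh, ht, -, hu, hv⟩ := exists_of_mem_GHT hg
    have h1 := Nat.pow_le_pow_right (n := 3) (by norm_num) (tzRank_lt hca hab hu)
    have h2 := Nat.pow_le_pow_right (n := 3) (by norm_num) (tzRank_lt hca hab hv)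
    have h3 : 0 < 3 ^ tzRank b₂ c₂ d₂ _ _ u := by positivity
    simp only [hh, ht, map_add, Finsupp.liftAddHom_apply_single, AddMonoidHom.coe_mulRight, ρ]
    rw [Nat.succ_eq_add_one, pow_succ] at h1 h2
    omega
  · rw [hdeg T, ← hT', ← hdeg T']
    simp only [Finsupp.liftAddHom_apply, AddMonoidHom.coe_mulRight]
    rw [Finsupp.sum, Finsupp.sum, Finset.sum_mul]
    exact Finset.sum_le_sum fun x _ =>
      Nat.mul_le_mul_left _ (Nat.pow_le_pow_right (by norm_num) (hρ x))

end

theorem single_add_single_le {V : Type*} {T : V →₀ ℕ} {x y : V} (hxy : x ≠ y) (hx : T x ≠ 0)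
    (hy : T y ≠ 0) : Finsupp.single x 1 + Finsupp.single y 1 ≤ T := by
  classical
  intro z
  rw [Finsupp.add_apply, Finsupp.single_apply, Finsupp.single_apply]
  split_ifs with h h' h'
  · exact absurd (h.trans h'.symm) hxy
  · subst h; omega
  · subst h'; omega
  · omega

theorem exists_eq_single_add {V : Type*} {T : V →₀ ℕ} {x : V} (hx : T x ≠ 0) :
    ∃ T', T = Finsupp.single x 1 + T' :=
  ⟨T - Finsupp.single x 1, (add_tsub_cancel_of_le (by simpa using Nat.one_le_iff_ne_zero.2 hx)).symm⟩

theorem sum_smul_le_of_nonpos {V : Type*} {φ : V → ℤ} (hφ : ∀ x, φ x ≤ 0) {T : V →₀ ℕ} {x : V}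
    (hx : T x ≠ 0) : T.sum (fun v e => e • φ v) ≤ φ x := by
  have hsingle := Finset.single_le_sum (f := fun v => -(T v • φ v)) (s := T.support)
    (fun v _ => neg_nonneg.2 (nsmul_nonpos (hφ v) _)) (Finsupp.mem_support_iff.2 hx)
  have hle : T x • φ x ≤ φ x := by
    rw [nsmul_eq_mul]
    have : (1 : ℤ) ≤ T x := by exact_mod_cast Nat.one_le_iff_ne_zero.2 hx
    nlinarith [hφ x]
  simp only [Finset.sum_neg_distrib] at hsingle
  rw [Finsupp.sum]
  linarith

theorem neg_one_le_sum_smul {V : Type*} {φ : V → ℤ} {T : V →₀ ℕ}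
    (h : ∀ x, T x ≠ 0 → -1 ≤ φ x)
    (h' : ∀ x y, Finsupp.single x 1 + Finsupp.single y 1 ≤ T → 0 ≤ φ x ∨ 0 ≤ φ y) :
    -1 ≤ T.sum (fun v e => e • φ v) := by
  by_cases hT : ∀ x, T x ≠ 0 → 0 ≤ φ x
  · have : 0 ≤ T.sum (fun v e => e • φ v) :=
      Finset.sum_nonneg fun x hx => nsmul_nonneg (hT x (Finsupp.mem_support_iff.1 hx)) _
    linarith
  · push Not at hT
    obtain ⟨x, hx, hx'⟩ := hT
    obtain ⟨T', rfl⟩ := exists_eq_single_add hx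
    have hadd := Finsupp.sum_add_index' (f := Finsupp.single x 1) (g := T')
      (h := fun v (e : ℕ) => e • φ v) (fun _ => zero_smul _ _) (fun _ _ _ => add_smul _ _ _)
    rw [hadd, Finsupp.sum_single_index (zero_smul ℕ (φ x)), one_smul]
    have : 0 ≤ T'.sum (fun v e => e • φ v) := by
      refine Finset.sum_nonneg fun y hy => nsmul_nonneg ?_ _
      refine (h' x y ?_).resolve_left hx'.not_ge
      gcongr
      simpa using Nat.one_le_iff_ne_zero.2 (Finsupp.mem_support_iff.1 hy)
    linarith [h x hx]

theorem exists_le_eq_quad {n : ℕ} {a b c d : Fin n} {m : Fin n →₀ ℕ} (hm : m ∈ BM a b ∪ BN b c d) :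
    ∃ i j, i ≤ j ∧ m = quad i j := by
  obtain ⟨i, j, rfl⟩ := exists_eq_quad hm
  rcases le_total i j with h | h
  · exact ⟨i, j, h, rfl⟩
  · exact ⟨j, i, h, quad_comm i j⟩

section

variable {n : ℕ} {S₁ S₂ : Set (Fin n →₀ ℕ)}

/-- The variable `T_{x_k x_l}` divides `V`. -/
def OccT (V : S₁ ⊕ S₂ →₀ ℕ) (k l : Fin n) : Prop :=
  ∃ u : S₁, (u : Fin n →₀ ℕ) = quad k l ∧ V (.inl u) ≠ 0

/-- The variable `Z_{x_r x_s}` divides `V`. -/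
def OccZ (V : S₁ ⊕ S₂ →₀ ℕ) (r s : Fin n) : Prop :=
  ∃ u : S₂, (u : Fin n →₀ ℕ) = quad r s ∧ V (.inr u) ≠ 0

/-- The product `T_{x_k x_l} T_{x_k' x_l'}` divides `V`. -/
def OccTT (V : S₁ ⊕ S₂ →₀ ℕ) (k l k' l' : Fin n) : Prop :=
  ∃ u v : S₁, (u : Fin n →₀ ℕ) = quad k l ∧ (v : Fin n →₀ ℕ) = quad k' l' ∧
    Finsupp.single (.inl u) 1 + Finsupp.single (.inl v) 1 ≤ V

/-- The product `Z_{x_r x_s} Z_{x_r' x_s'}` divides `V`. -/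
def OccZZ (V : S₁ ⊕ S₂ →₀ ℕ) (r s r' s' : Fin n) : Prop :=
  ∃ u v : S₂, (u : Fin n →₀ ℕ) = quad r s ∧ (v : Fin n →₀ ℕ) = quad r' s' ∧
    Finsupp.single (.inr u) 1 + Finsupp.single (.inr v) 1 ≤ V

variable {V W : S₁ ⊕ S₂ →₀ ℕ} {k l k' l' r s r' s' : Fin n}

theorem OccT.symm (h : OccT V k l) : OccT V l k := by
  simpa only [OccT, quad_comm l k] using h

theorem OccZ.symm (h : OccZ V r s) : OccZ V s r := by
  simpa only [OccZ, quad_comm s r] using h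

theorem OccTT.swap_left (h : OccTT V k l k' l') : OccTT V l k k' l' := by
  simpa only [OccTT, quad_comm l k] using h

theorem OccTT.swap_right (h : OccTT V k l k' l') : OccTT V k l l' k' := by
  simpa only [OccTT, quad_comm l' k'] using h

theorem OccZZ.swap_right (h : OccZZ V r s r' s') : OccZZ V r s s' r' := by
  simpa only [OccZZ, quad_comm s' r'] using h

theorem OccTT.right (h : OccTT V k l k' l') : OccT V k' l' := by
  obtain ⟨u, v, hu, hv, h⟩ := h
  have := h (.inl v)
  simp only [Finsupp.add_apply, Finsupp.single_eq_same] at this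
  exact ⟨v, hv, by omega⟩

theorem OccTT.left (h : OccTT V k l k' l') : OccT V k l := by
  obtain ⟨u, v, hu, hv, h⟩ := h
  have := h (.inl u)
  simp only [Finsupp.add_apply, Finsupp.single_eq_same] at this
  exact ⟨u, hu, by omega⟩

theorem OccZZ.right (h : OccZZ V r s r' s') : OccZ V r' s' := by
  obtain ⟨u, v, hu, hv, h⟩ := h
  have := h (.inr v)
  simp only [Finsupp.add_apply, Finsupp.single_eq_same] at this
  exact ⟨v, hv, by omega⟩

theorem OccT.pair (h : OccT V k l) (h' : OccT V k' l')
    (hne : ¬ (min (k : ℕ) l = min (k' : ℕ) l' ∧ max (k : ℕ) l = max (k' : ℕ) l')) :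
    OccTT V k l k' l' := by
  obtain ⟨u, hu, hV⟩ := h
  obtain ⟨v, hv, hV'⟩ := h'
  refine ⟨u, v, hu, hv, single_add_single_le ?_ hV hV'⟩
  rintro h
  rw [Sum.inl.inj h, hv] at hu
  exact hne (quad_inj hu.symm)

theorem OccZ.pair (h : OccZ V r s) (h' : OccZ V r' s')
    (hne : ¬ (min (r : ℕ) s = min (r' : ℕ) s' ∧ max (r : ℕ) s = max (r' : ℕ) s')) :
    OccZZ V r s r' s' := by
  obtain ⟨u, hu, hV⟩ := h
  obtain ⟨v, hv, hV'⟩ := h'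
  refine ⟨u, v, hu, hv, single_add_single_le ?_ hV hV'⟩
  rintro h
  rw [Sum.inr.inj h, hv] at hu
  exact hne (quad_inj hu.symm)

theorem exists_inr_of_fiberMap_eq (h : fiberMap (TZexp S₁ S₂) V = fiberMap (TZexp S₁ S₂) W)
    {y : S₂} (hy : W (.inr y) ≠ 0) : ∃ v : S₂, V (.inr v) ≠ 0 := by
  by_contra! hV
  obtain ⟨W', rfl⟩ := exists_eq_single_add hy
  have h := DFunLike.congr_fun h (Sum.inr 1)
  rw [fiberMap_add, fiberMap_single, Finsupp.add_apply, TZexp_inr_inr, fiberMap_apply,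
    Finsupp.sum, Finset.sum_eq_zero] at h
  · simp at h
    omega
  · rintro (x | x) -
    · simp [TZexp_inl_inr]
    · simp [hV]

theorem exists_pair_of_fiberMap_eq (h : fiberMap (TZexp S₁ S₂) V = fiberMap (TZexp S₁ S₂) W)
    {x y : S₁ ⊕ S₂} (hx : V x ≠ 0) (hy : W y ≠ 0) {i : Fin n}
    (hxy : TZexp S₁ S₂ x (.inl i) < TZexp S₁ S₂ y (.inl i)) :
    ∃ x', Finsupp.single x 1 + Finsupp.single x' 1 ≤ V ∧ TZexp S₁ S₂ x' (.inl i) ≠ 0 := by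
  obtain ⟨V', rfl⟩ := exists_eq_single_add hx
  obtain ⟨W', rfl⟩ := exists_eq_single_add hy
  have h := DFunLike.congr_fun h (Sum.inl i)
  rw [fiberMap_add, fiberMap_single, fiberMap_add, fiberMap_single, Finsupp.add_apply,
    Finsupp.add_apply] at h
  have hne : fiberMap (TZexp S₁ S₂) V' (Sum.inl i) ≠ 0 := by omega
  rw [fiberMap_apply] at hne
  obtain ⟨x', hx', hne⟩ := Finset.exists_ne_zero_of_sum_ne_zero hne
  refine ⟨x', ?_, right_ne_zero_of_mul hne⟩
  gcongr
  simpa using Nat.one_le_iff_ne_zero.2 (Finsupp.mem_support_iff.1 hx')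

theorem exists_of_fiberMap_eq (h : fiberMap (TZexp S₁ S₂) V = fiberMap (TZexp S₁ S₂) W)
    {y : S₁ ⊕ S₂} (hy : W y ≠ 0) {i : Fin n} (hi : TZexp S₁ S₂ y (.inl i) ≠ 0) :
    ∃ x, V x ≠ 0 ∧ TZexp S₁ S₂ x (.inl i) ≠ 0 := by
  obtain ⟨W', rfl⟩ := exists_eq_single_add hy
  have h := DFunLike.congr_fun h (Sum.inl i)
  rw [fiberMap_add, fiberMap_single, Finsupp.add_apply] at h
  have hne : fiberMap (TZexp S₁ S₂) V (Sum.inl i) ≠ 0 := by omega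
  rw [fiberMap_apply] at hne
  obtain ⟨x, hx, hne⟩ := Finset.exists_ne_zero_of_sum_ne_zero hne
  exact ⟨x, Finsupp.mem_support_iff.1 hx, right_ne_zero_of_mul hne⟩

theorem quad_eq_of_apply_ne_zero {p q i : Fin n} (h : quad p q i ≠ 0) :
    ∃ l, quad p q = quad i l := by
  rw [quad_apply] at h
  split_ifs at h with h1 h2 h2
  · exact ⟨q, by rw [Fin.ext h1]⟩
  · exact ⟨q, by rw [Fin.ext h1]⟩
  · exact ⟨p, by rw [Fin.ext h2, quad_comm]⟩
  · exact absurd rfl h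

/-- The integral weight on `K[x, t, z]` giving `x_i` weight `f i`, `t` weight `-τ` and `z`
weight `-ζ`. -/
noncomputable def tzWeight (f : ℕ → ℤ) (τ ζ : ℤ) : ((Fin n ⊕ Fin 2) →₀ ℕ) →+ ℤ :=
  Finsupp.liftAddHom fun s => (AddMonoidHom.mulRight
    (Sum.elim (fun i : Fin n => f i) ![-τ, -ζ] s)).comp (Nat.castAddMonoidHom ℤ)

theorem tzWeight_quad (f : ℕ → ℤ) (τ ζ : ℤ) (i j : Fin n) (k : Fin 2) :
    tzWeight f τ ζ (Finsupp.mapDomain Sum.inl (quad i j) + Finsupp.single (Sum.inr k) 1) =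
      f i + f j + ![-τ, -ζ] k := by
  simp only [tzWeight, quad, Finsupp.mapDomain_add, Finsupp.mapDomain_single, map_add,
    Finsupp.liftAddHom_apply_single]
  simp

end

section

variable {n : ℕ} {a₁ b₁ c₁ d₁ a₂ b₂ c₂ d₂ : Fin n}
  {V W : ↥(BM a₁ b₁ ∪ BN b₁ c₁ d₁) ⊕ ↥(BM a₂ b₂ ∪ BN b₂ c₂ d₂) →₀ ℕ}
  {k l k' l' r s r' s' : Fin n}

theorem OccT.pairMem (h11 : c₁ < a₁) (h12 : a₁ ≤ b₁) (h : OccT V k l) :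
    PairMem a₁ b₁ c₁ d₁ k l := by
  obtain ⟨u, hu, -⟩ := h
  exact (quad_mem_iff h11 h12).1 (hu ▸ u.2)

theorem OccZ.pairMem (h21 : c₂ < a₂) (h22 : a₂ ≤ b₂) (h : OccZ V r s) :
    PairMem a₂ b₂ c₂ d₂ r s := by
  obtain ⟨u, hu, -⟩ := h
  exact (quad_mem_iff h21 h22).1 (hu ▸ u.2)

theorem IsIrred.not_occTT (hV : IsIrred (GHT a₁ b₁ c₁ d₁ a₂ b₂ c₂ d₂) V)
    (h11 : c₁ < a₁) (h12 : a₁ ≤ b₁) (h : OccTT V k l k' l')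
    (hk : PairMem a₁ b₁ c₁ d₁ k k') (hl : PairMem a₁ b₁ c₁ d₁ l l')
    (h1 : PairRlex k l l l') (h2 : PairRlex k' l' l l') : False := by
  obtain ⟨u, v, hu, hv, hle⟩ := h
  refine hV _ (.inl (.inl ⟨⟨Finsupp.single u 1 + Finsupp.single v 1,
    Finsupp.single ⟨quad k k', (quad_mem_iff h11 h12).2 hk⟩ 1 +
      Finsupp.single ⟨quad l l', (quad_mem_iff h11 h12).2 hl⟩ 1⟩,
    ⟨u, v, _, _, ?_, ?_, ?_, rfl, rfl⟩, rfl⟩)) ?_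
  · rw [hu, hv]
    simp only [quad]
    abel
  · rw [hu]
    exact rlexGt_quad_of_pairRlex h1
  · rw [hv]
    exact rlexGt_quad_of_pairRlex h2
  · simpa [MarkedBinomial.map, Finsupp.mapDomain_add, Finsupp.mapDomain_single] using hle

theorem IsIrred.not_occZZ (hV : IsIrred (GHT a₁ b₁ c₁ d₁ a₂ b₂ c₂ d₂) V)
    (h21 : c₂ < a₂) (h22 : a₂ ≤ b₂) (h : OccZZ V r s r' s')
    (hr : PairMem a₂ b₂ c₂ d₂ r r') (hs : PairMem a₂ b₂ c₂ d₂ s s')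
    (h1 : PairMrlex b₂ r s s s') (h2 : PairMrlex b₂ r' s' s s') : False := by
  obtain ⟨u, v, hu, hv, hle⟩ := h
  refine hV _ (.inl (.inr ⟨⟨Finsupp.single u 1 + Finsupp.single v 1,
    Finsupp.single ⟨quad r r', (quad_mem_iff h21 h22).2 hr⟩ 1 +
      Finsupp.single ⟨quad s s', (quad_mem_iff h21 h22).2 hs⟩ 1⟩,
    ⟨u, v, _, _, ?_, ?_, ?_, rfl, rfl⟩, rfl⟩)) ?_
  · rw [hu, hv]
    simp only [quad]
    abel
  · rw [hu]
    exact (mrlexGt_quad_iff h21 h22 ((quad_mem_iff h21 h22).1 (hu ▸ u.2)) hs).2 h1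
  · rw [hv]
    exact (mrlexGt_quad_iff h21 h22 ((quad_mem_iff h21 h22).1 (hv ▸ v.2)) hs).2 h2
  · simpa [MarkedBinomial.map, Finsupp.mapDomain_add, Finsupp.mapDomain_single] using hle

theorem IsIrred.not_exchange (hV : IsIrred (GHT a₁ b₁ c₁ d₁ a₂ b₂ c₂ d₂) V)
    (h11 : c₁ < a₁) (h12 : a₁ ≤ b₁) (h21 : c₂ < a₂) (h22 : a₂ ≤ b₂)
    (h : OccT V k l) (h' : OccZ V r s) {x y z t : Fin n}
    (heq : quad k l + quad r s = quad x y + quad z t)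
    (hx : PairMem a₁ b₁ c₁ d₁ x y) (hz : PairMem a₂ b₂ c₂ d₂ z t)
    (h2 : PairMrlex b₂ r s z t) : False := by
  obtain ⟨u, hu, huV⟩ := h
  obtain ⟨v, hv, hvV⟩ := h'
  refine hV ⟨Finsupp.single (.inl u) 1 + Finsupp.single (.inr v) 1,
    Finsupp.single (.inl ⟨quad x y, (quad_mem_iff h11 h12).2 hx⟩) 1 +
      Finsupp.single (.inr ⟨quad z t, (quad_mem_iff h21 h22).2 hz⟩) 1⟩
    (.inr ⟨u, _, v, _, ?_, ?_, rfl, rfl⟩) (single_add_single_le (by simp) huV hvV)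
  · rw [hu, hv, heq]
  · rw [hv]
    exact (mrlexGt_quad_iff h21 h22 ((quad_mem_iff h21 h22).1 (hv ▸ v.2)) hz).2 h2

/-- A mixed pair of an irreducible monomial admits no exchange of one index. -/
theorem IsIrred.not_occT_occZ (hV : IsIrred (GHT a₁ b₁ c₁ d₁ a₂ b₂ c₂ d₂) V)
    (h11 : c₁ < a₁) (h12 : a₁ ≤ b₁) (h21 : c₂ < a₂) (h22 : a₂ ≤ b₂)
    (h : OccT V k l) (h' : OccZ V r s)
    (hk : PairMem a₁ b₁ c₁ d₁ k r) (hl : PairMem a₂ b₂ c₂ d₂ l s)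
    (h2 : PairMrlex b₂ r s l s) : False :=
  hV.not_exchange h11 h12 h21 h22 h h' (by simp only [quad]; abel) hk hl h2

theorem occTT_or_occZ_of_fiberMap_eq (h : fiberMap (TZexp _ _) V = fiberMap (TZexp _ _) W)
    (h' : OccT V k l) {i j : Fin n} (hW : OccT W i j) (hlt : quad k l i < quad i j i) :
    ∃ m, OccTT V k l i m ∨ OccZ V i m := by
  obtain ⟨u, hu, hV⟩ := h'
  obtain ⟨w, hw, hW⟩ := hW
  obtain ⟨x | x, hle, hx⟩ := exists_pair_of_fiberMap_eq h hV hW (i := i)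
    (by simpa only [TZexp_inl_inl, hu, hw] using hlt)
  · rw [TZexp_inl_inl] at hx
    obtain ⟨p, q, hpq⟩ := exists_eq_quad x.2
    rw [hpq] at hx
    obtain ⟨m, hm⟩ := quad_eq_of_apply_ne_zero hx
    exact ⟨m, .inl ⟨u, x, hu, hpq.trans hm, hle⟩⟩
  · rw [TZexp_inr_inl] at hx
    obtain ⟨p, q, hpq⟩ := exists_eq_quad x.2
    rw [hpq] at hx
    obtain ⟨m, hm⟩ := quad_eq_of_apply_ne_zero hx
    refine ⟨m, .inr ⟨x, hpq.trans hm, ?_⟩⟩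
    have := hle (.inr x)
    simp only [Finsupp.add_apply, Finsupp.single_eq_same] at this
    omega

theorem occT_or_occZZ_of_fiberMap_eq (h : fiberMap (TZexp _ _) V = fiberMap (TZexp _ _) W)
    (h' : OccZ V r s) {i j : Fin n} (hW : OccZ W i j) (hlt : quad r s i < quad i j i) :
    ∃ m, OccT V i m ∨ OccZZ V r s i m := by
  obtain ⟨u, hu, hV⟩ := h'
  obtain ⟨w, hw, hW⟩ := hW
  obtain ⟨x | x, hle, hx⟩ := exists_pair_of_fiberMap_eq h hV hW (i := i)
    (by simpa only [TZexp_inr_inl, hu, hw] using hlt)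
  · rw [TZexp_inl_inl] at hx
    obtain ⟨p, q, hpq⟩ := exists_eq_quad x.2
    rw [hpq] at hx
    obtain ⟨m, hm⟩ := quad_eq_of_apply_ne_zero hx
    refine ⟨m, .inl ⟨x, hpq.trans hm, ?_⟩⟩
    have := hle (.inl x)
    simp only [Finsupp.add_apply, Finsupp.single_eq_same] at this
    omega
  · rw [TZexp_inr_inl] at hx
    obtain ⟨p, q, hpq⟩ := exists_eq_quad x.2
    rw [hpq] at hx
    obtain ⟨m, hm⟩ := quad_eq_of_apply_ne_zero hx
    exact ⟨m, .inr ⟨u, x, hu, hpq.trans hm, hle⟩⟩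

theorem occT_or_occZ_of_fiberMap_eq (h : fiberMap (TZexp _ _) V = fiberMap (TZexp _ _) W)
    {i j : Fin n} (hW : OccT W i j ∨ OccZ W i j) : ∃ m, OccT V i m ∨ OccZ V i m := by
  have hne : quad i j i ≠ 0 := by simp [quad_apply]
  obtain ⟨x | x, hx, hx'⟩ : ∃ x, V x ≠ 0 ∧ TZexp _ _ x (.inl i) ≠ 0 := by
    rcases hW with ⟨w, hw, hW⟩ | ⟨w, hw, hW⟩
    · exact exists_of_fiberMap_eq h hW (by rwa [TZexp_inl_inl, hw])
    · exact exists_of_fiberMap_eq h hW (by rwa [TZexp_inr_inl, hw])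
  · rw [TZexp_inl_inl] at hx'
    obtain ⟨p, q, hpq⟩ := exists_eq_quad x.2
    rw [hpq] at hx'
    obtain ⟨m, hm⟩ := quad_eq_of_apply_ne_zero hx'
    exact ⟨m, .inl ⟨x, hpq.trans hm, hx⟩⟩
  · rw [TZexp_inr_inl] at hx'
    obtain ⟨p, q, hpq⟩ := exists_eq_quad x.2
    rw [hpq] at hx'
    obtain ⟨m, hm⟩ := quad_eq_of_apply_ne_zero hx'
    exact ⟨m, .inr ⟨x, hpq.trans hm, hx⟩⟩

theorem exists_occZ_of_fiberMap_eq (h : fiberMap (TZexp _ _) V = fiberMap (TZexp _ _) W)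
    {i j : Fin n} (hW : OccZ W i j) : ∃ r s, OccZ V r s := by
  obtain ⟨w, -, hW⟩ := hW
  obtain ⟨x, hx⟩ := exists_inr_of_fiberMap_eq h hW
  obtain ⟨p, q, hpq⟩ := exists_eq_quad x.2
  exact ⟨p, q, x, hpq, hx⟩

/-- Weight comparison within a fiber, allowing at most one factor `T` of weight `τ - 1`. -/
theorem false_of_weight_of_defect (h11 : c₁ < a₁) (h12 : a₁ ≤ b₁) (h21 : c₂ < a₂) (h22 : a₂ ≤ b₂)
    (h : fiberMap (TZexp _ _) V = fiberMap (TZexp _ _) W) (f : ℕ → ℤ) (τ ζ : ℤ)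
    (hT : ∀ k l : Fin n, k ≤ l → OccT V k l → τ - 1 ≤ f k + f l)
    (hTT : ∀ k l k' l' : Fin n, k ≤ l → k' ≤ l' → OccTT V k l k' l' → τ ≤ f k + f l ∨ τ ≤ f k' + f l')
    (hZ : ∀ r s : Fin n, r ≤ s → OccZ V r s → ζ ≤ f r + f s)
    (hT' : ∀ k l : Fin n, k ≤ l → PairMem a₁ b₁ c₁ d₁ k l → f k + f l ≤ τ)
    (hZ' : ∀ r s : Fin n, r ≤ s → PairMem a₂ b₂ c₂ d₂ r s → f r + f s ≤ ζ)
    {i j : Fin n} (hw : OccZ W i j) (hlt : f i + f j < ζ - 1) : False := by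
  have hsum := congrArg (tzWeight f τ ζ) h
  rw [map_fiberMap, map_fiberMap] at hsum
  obtain ⟨w, hw, hW⟩ := hw
  have h1 : V.sum (fun v e => e • tzWeight f τ ζ (TZexp _ _ v)) ≥ -1 := by
    refine neg_one_le_sum_smul ?_ ?_
    · rintro (x | x) hx <;> obtain ⟨p, q, hle₀, hpq⟩ := exists_le_eq_quad x.2 <;>
        simp only [TZexp, Sum.elim_inl, Sum.elim_inr, hpq, tzWeight_quad]
      · have := hT p q hle₀ ⟨x, hpq, hx⟩
        simp
        linarith
      · have := hZ p q hle₀ ⟨x, hpq, hx⟩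
        simp
        linarith
    · have hZ0 : ∀ (x : ↥(BM a₂ b₂ ∪ BN b₂ c₂ d₂))
          (y : ↥(BM a₁ b₁ ∪ BN b₁ c₁ d₁) ⊕ ↥(BM a₂ b₂ ∪ BN b₂ c₂ d₂)),
          Finsupp.single (Sum.inr x) 1 + Finsupp.single y 1 ≤ V →
          0 ≤ tzWeight f τ ζ (TZexp (BM a₁ b₁ ∪ BN b₁ c₁ d₁) _ (.inr x)) := by
        intro x y hle
        have hx := hle (.inr x)
        simp only [Finsupp.add_apply, Finsupp.single_eq_same] at hx
        obtain ⟨p, q, hle₀, hpq⟩ := exists_le_eq_quad x.2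
        have := hZ p q hle₀ ⟨x, hpq, by omega⟩
        simp only [TZexp, Sum.elim_inr, hpq, tzWeight_quad]
        simp
        linarith
      rintro (x | x) (y | y) hle
      · obtain ⟨p, q, hle₀, hpq⟩ := exists_le_eq_quad x.2
        obtain ⟨p', q', hle₁, hpq'⟩ := exists_le_eq_quad y.2
        have := hTT p q p' q' hle₀ hle₁ ⟨x, y, hpq, hpq', hle⟩
        simp only [TZexp, Sum.elim_inl, hpq, hpq', tzWeight_quad]
        simp only [Matrix.cons_val_zero]
        omega
      · exact .inr (hZ0 y _ (by rwa [add_comm]))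
      · exact .inl (hZ0 x _ hle)
      · exact .inl (hZ0 x _ hle)
  have h2 : W.sum (fun v e => e • tzWeight f τ ζ (TZexp _ _ v)) ≤
      tzWeight f τ ζ (TZexp (BM a₁ b₁ ∪ BN b₁ c₁ d₁) _ (.inr w)) := by
    refine sum_smul_le_of_nonpos ?_ hW
    rintro (x | x) <;> obtain ⟨p, q, hle₀, hpq⟩ := exists_le_eq_quad x.2 <;>
      simp only [TZexp, Sum.elim_inl, Sum.elim_inr, hpq, tzWeight_quad]
    · have := hT' p q hle₀ ((quad_mem_iff h11 h12).1 (hpq ▸ x.2))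
      simp
      linarith
    · have := hZ' p q hle₀ ((quad_mem_iff h21 h22).1 (hpq ▸ x.2))
      simp
      linarith
  have h3 : tzWeight f τ ζ (TZexp (BM a₁ b₁ ∪ BN b₁ c₁ d₁) _ (.inr w)) = f i + f j - ζ := by
    simp [TZexp, hw, tzWeight_quad, sub_eq_add_neg]
  linarith

/-- Weight comparison within a fiber. -/
theorem false_of_weight (h11 : c₁ < a₁) (h12 : a₁ ≤ b₁) (h21 : c₂ < a₂) (h22 : a₂ ≤ b₂)
    (h : fiberMap (TZexp _ _) V = fiberMap (TZexp _ _) W) (f : ℕ → ℤ) (τ ζ : ℤ)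
    (hT : ∀ k l : Fin n, k ≤ l → OccT V k l → τ ≤ f k + f l)
    (hZ : ∀ r s : Fin n, r ≤ s → OccZ V r s → ζ ≤ f r + f s)
    (hT' : ∀ k l : Fin n, k ≤ l → PairMem a₁ b₁ c₁ d₁ k l → f k + f l ≤ τ)
    (hZ' : ∀ r s : Fin n, r ≤ s → PairMem a₂ b₂ c₂ d₂ r s → f r + f s ≤ ζ)
    {i j : Fin n} (hw : OccZ W i j) (hlt : f i + f j < ζ) : False := by
  refine false_of_weight_of_defect h11 h12 h21 h22 h (fun x => 2 * f x) (2 * τ) (2 * ζ)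
    (fun k l hle hkl => ?_) (fun k l k' l' hle _ hkl => .inl ?_) (fun r s hle hrs => ?_)
    (fun k l hle hkl => ?_) (fun r s hle hrs => ?_) hw ?_
  · linarith [hT k l hle hkl]
  · linarith [hT k l hle hkl.left]
  · linarith [hZ r s hle hrs]
  · linarith [hT' k l hle hkl]
  · linarith [hZ' r s hle hrs]
  · linarith

end

section

variable {n : ℕ} {a₁ b₁ c₁ d₁ a₂ b₂ c₂ d₂ : Fin n}
  {V W : ↥(BM a₁ b₁ ∪ BN b₁ c₁ d₁) ⊕ ↥(BM a₂ b₂ ∪ BN b₂ c₂ d₂) →₀ ℕ}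

/-- The `T`-variables of `W` are not smaller than all the variables of an irreducible `V` in the
same fiber. -/
theorem IsIrred.false_of_occT (hV : IsIrred (GHT a₁ b₁ c₁ d₁ a₂ b₂ c₂ d₂) V)
    (h11 : c₁ < a₁) (h12 : a₁ ≤ b₁) (h : fiberMap (TZexp _ _) V = fiberMap (TZexp _ _) W)
    {i j : Fin n} (hW : OccT W i j) (hT : ∀ k l : Fin n, OccT V k l → PairRlex k l i j)
    (hZ : ∀ r s : Fin n, ¬ OccZ V r s) : False := by
  wlog hij : i ≤ j generalizing i j
  · exact this hW.symm (fun k l hkl => by have := hT k l hkl; unfold PairRlex at *; omega)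
      (le_of_not_ge hij)
  obtain ⟨k, hk | hk⟩ := occT_or_occZ_of_fiberMap_eq h (.inl hW.symm)
  swap
  · exact hZ _ _ hk
  have hk' := hT _ _ hk
  have hki : (k : ℕ) < i := by unfold PairRlex at hk'; rw [Fin.le_def] at hij; omega
  obtain ⟨l, hl | hl⟩ := occTT_or_occZ_of_fiberMap_eq h hk hW
    (by rw [Fin.le_def] at hij; rw [quad_apply, quad_apply]; split_ifs <;> omega)
  swap
  · exact hZ _ _ hl
  have hl' := hT _ _ hl.right
  have hl'' := hl.right.pairMem h11 h12
  have hW' := hW.pairMem h11 h12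
  rw [Fin.lt_def, Fin.le_def] at *
  refine hV.not_occTT h11 h12 hl.swap_left.swap_right ?_ ?_ ?_ ?_ <;>
    unfold PairMem PairRlex at * <;> omega

/-- If `Z_{x_i x_j}` divides `W` and some `Z`-variable of `V` lies in the same block, then
`Z_{x_i x_j}` is not smaller than all `Z`-variables of an irreducible `V` in the same fiber. -/
theorem IsIrred.false_of_occZ_of_iff (hV : IsIrred (GHT a₁ b₁ c₁ d₁ a₂ b₂ c₂ d₂) V)
    (h11 : c₁ < a₁) (h12 : a₁ ≤ b₁) (h21 : c₂ < a₂) (h22 : a₂ ≤ b₂)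
    (h : fiberMap (TZexp _ _) V = fiberMap (TZexp _ _) W)
    {i j : Fin n} (hW : OccZ W i j) (hZ : ∀ r s : Fin n, OccZ V r s → PairMrlex b₂ r s i j)
    {r s : Fin n} (hrs : OccZ V r s)
    (hiff : (b₂ : ℕ) < max (r : ℕ) s ↔ (b₂ : ℕ) < max (i : ℕ) j) : False := by
  wlog hij : i ≤ j generalizing i j
  · exact this hW.symm (fun k l hkl => by have := hZ k l hkl; unfold PairMrlex PairRlex at *; omega)
      (by rwa [max_comm (j : ℕ)]) (le_of_not_ge hij)
  wlog hrs' : r ≤ s generalizing r s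
  · exact this hrs.symm (by rwa [max_comm (s : ℕ)]) (le_of_not_ge hrs')
  have hW' := hW.pairMem h21 h22
  have hrs2 := hrs.pairMem h21 h22
  have hrs3 := hZ _ _ hrs
  have hlast : ∀ q : Fin n, OccZ V q j → ((b₂ : ℕ) < max (q : ℕ) j ↔ (b₂ : ℕ) < max (i : ℕ) j) →
      False := by
    intro q hq hq'
    have hq2 := hZ _ _ hq
    have hqi : (q : ℕ) < i := by
      unfold PairMrlex PairRlex at hq2; rw [Fin.le_def] at hij; omega
    obtain ⟨l, hl | hl⟩ := occT_or_occZZ_of_fiberMap_eq h hq hW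
      (by rw [Fin.le_def] at hij; rw [quad_apply, quad_apply]; split_ifs <;> omega)
    · have hl' := hl.pairMem h11 h12
      rw [Fin.lt_def, Fin.le_def] at *
      refine hV.not_occT_occZ h11 h12 h21 h22 hl.symm hq ?_ hW' ?_
      · unfold PairMem at *; omega
      · unfold PairMrlex PairRlex at *; omega
    · have hl' := hl.right.pairMem h21 h22
      have hl2 := hZ _ _ hl.right
      rw [Fin.lt_def, Fin.le_def] at *
      refine hV.not_occZZ h21 h22 hl.swap_right ?_ (hW.symm.pairMem h21 h22) ?_ ?_
      · unfold PairMem at *; omega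
      · unfold PairMrlex PairRlex at *; omega
      · unfold PairMrlex PairRlex at *; omega
  obtain ⟨l, hl⟩ := occT_or_occZ_of_fiberMap_eq h (.inr hW.symm)
  by_cases hsj : (s : ℕ) = j
  · obtain rfl := Fin.ext hsj
    exact hlast r hrs hiff
  have hlj : ¬ OccT V j l := by
    intro hl
    have hl' := hl.pairMem h11 h12
    rw [Fin.lt_def, Fin.le_def] at *
    refine hV.not_occT_occZ h11 h12 h21 h22 hl.symm hrs.symm ?_ (?_ : PairMem _ _ _ _ j r) ?_
    · unfold PairMem PairMrlex PairRlex at *; omega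
    · unfold PairMem PairMrlex PairRlex at *; omega
    · unfold PairMrlex PairRlex at *; omega
  have hl := hl.resolve_left hlj
  by_cases hl2 : (b₂ : ℕ) < max (l : ℕ) j ↔ (b₂ : ℕ) < max (i : ℕ) j
  · exact hlast l hl.symm hl2
  have hl3 := hZ _ _ hl
  have hl' := hl.pairMem h21 h22
  rw [Fin.lt_def, Fin.le_def] at *
  refine hV.not_occZZ h21 h22 (hl.symm.pair hrs.symm ?_) ?_ (?_ : PairMem _ _ _ _ j r) ?_ ?_ <;>
    unfold PairMem PairMrlex PairRlex at * <;> omega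

end

/-- An irreducible `V` and a variable `Z_{x_i x_j}` with `x_i x_j ∈ B_{M₂}` dividing a monomial
`W` of the same fiber, where all `Z`-variables of `V` belong to `B_{N₂}`. -/
structure BlockGap {n : ℕ} (a₁ b₁ c₁ d₁ a₂ b₂ c₂ d₂ : Fin n)
    (V W : ↥(BM a₁ b₁ ∪ BN b₁ c₁ d₁) ⊕ ↥(BM a₂ b₂ ∪ BN b₂ c₂ d₂) →₀ ℕ) (i j : Fin n) : Prop where
  h11 : (c₁ : ℕ) < a₁
  h12 : (a₁ : ℕ) ≤ b₁
  h13 : (b₁ : ℕ) < d₁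
  h21 : (c₂ : ℕ) < a₂
  h22 : (a₂ : ℕ) ≤ b₂
  h23 : (b₂ : ℕ) < d₂
  hd : (d₁ : ℕ) ≤ d₂
  irred : IsIrred (GHT a₁ b₁ c₁ d₁ a₂ b₂ c₂ d₂) V
  fiber : fiberMap (TZexp _ _) V = fiberMap (TZexp _ _) W
  occ : OccZ W i j
  le : max (i : ℕ) j ≤ b₂
  lt : ∀ r s : Fin n, OccZ V r s → (b₂ : ℕ) < max (r : ℕ) s

namespace BlockGap

variable {n : ℕ} {a₁ b₁ c₁ d₁ a₂ b₂ c₂ d₂ i j : Fin n}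
  {V W : ↥(BM a₁ b₁ ∪ BN b₁ c₁ d₁) ⊕ ↥(BM a₂ b₂ ∪ BN b₂ c₂ d₂) →₀ ℕ}

theorem occZ_spec (H : BlockGap a₁ b₁ c₁ d₁ a₂ b₂ c₂ d₂ V W i j) {r s : Fin n}
    (h : OccZ V r s) (hrs : r ≤ s) : (r : ℕ) ≤ c₂ ∧ (b₂ : ℕ) < s ∧ (s : ℕ) ≤ d₂ := by
  have h1 := H.lt _ _ h
  have h2 := h.pairMem H.h21 H.h22
  rw [Fin.le_def] at hrs
  unfold PairMem at h2
  omega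

theorem occT_spec (H : BlockGap a₁ b₁ c₁ d₁ a₂ b₂ c₂ d₂ V W i j) {k l : Fin n}
    (h : OccT V k l) (hkl : k ≤ l) : (k : ℕ) ≤ a₁ ∧ (l : ℕ) ≤ d₁ ∧ ((k : ℕ) ≤ c₁ ∨ (l : ℕ) ≤ b₁) := by
  have h1 := H.h11
  have h2 := H.h12
  have h3 := H.h13
  have h4 := h.pairMem H.h11 H.h12
  rw [Fin.le_def] at hkl
  unfold PairMem at h4
  omega

theorem le_of_occT_of_occZ (H : BlockGap a₁ b₁ c₁ d₁ a₂ b₂ c₂ d₂ V W i j) {k l r s : Fin n}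
    (h : OccT V k l) (h' : OccZ V r s) (hkl : k ≤ l) (hrs : r ≤ s) : (l : ℕ) ≤ s := by
  by_contra! hsl
  have h1 := H.occZ_spec h' hrs
  have h2 := H.occT_spec h hkl
  obtain ⟨h11, h12, h13, h21, h22, h23, hd, -, -, -, -, -⟩ := id H
  rw [Fin.le_def] at hkl hrs
  have h3 := h.pairMem H.h11 H.h12
  refine H.irred.not_occT_occZ H.h11 H.h12 H.h21 H.h22 h h'.symm ?_ ?_ ?_ <;>
    simp only [PairMem, PairMrlex, PairRlex] at * <;> omega

theorem not_pairMem (H : BlockGap a₁ b₁ c₁ d₁ a₂ b₂ c₂ d₂ V W i j) {k l r s : Fin n}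
    (h : OccT V k l) (h' : OccZ V r s) (hkb : (k : ℕ) ≤ b₂) (hrs : r ≤ s) :
    ¬ PairMem a₁ b₁ c₁ d₁ l s := by
  intro hls
  have h1 := H.occZ_spec h' hrs
  obtain ⟨h11, h12, h13, h21, h22, h23, hd, -, -, -, -, -⟩ := id H
  rw [Fin.le_def] at hrs
  refine H.irred.not_occT_occZ H.h11 H.h12 H.h21 H.h22 h.symm h'.symm hls ?_ ?_ <;>
    simp only [PairMem, PairMrlex, PairRlex] at * <;> omega

/-- Swapping one index between two `T`-factors. -/
theorem not_exchange (H : BlockGap a₁ b₁ c₁ d₁ a₂ b₂ c₂ d₂ V W i j) {k l k' l' : Fin n}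
    (h : OccT V k l) (h' : OccT V k' l') (hk' : k' ≤ l') (hkk : (k : ℕ) < k') (hll : (l' : ℕ) < l)
    (h1 : PairMem a₁ b₁ c₁ d₁ k l') (h2 : PairMem a₁ b₁ c₁ d₁ k' l) : False := by
  rw [Fin.le_def] at hk'
  refine H.irred.not_occTT H.h11 H.h12 (h.pair h'.symm ?_) h1 (?_ : PairMem _ _ _ _ l k') ?_ ?_ <;>
    simp only [PairMem, PairRlex] at * <;> omega

/-- The two-step weight with jumps after `e` and `m`. -/
def stepWeight (e m x : ℕ) : ℤ := (if e < x then 1 else 0) + if m < x then 1 else 0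

theorem exists_occZ_le (H : BlockGap a₁ b₁ c₁ d₁ a₂ b₂ c₂ d₂ V W i j) :
    ∃ r s : Fin n, r ≤ s ∧ OccZ V r s ∧ (s : ℕ) ≤ d₁ := by
  by_contra! hne
  have h1 := fun r s h h' => H.occZ_spec (r := r) (s := s) h h'
  obtain ⟨h11, h12, h13, h21, h22, h23, hd, -, -, -, hij, -⟩ := id H
  refine false_of_weight H.h11 H.h12 H.h21 H.h22 H.fiber
    (fun x => if max (d₁ : ℕ) b₂ < x then 1 else 0) 0 1 (fun k l hkl h => ?_) (fun r s hrs h => ?_)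
    (fun k l hkl h => ?_) (fun r s hrs h => ?_) H.occ ?_
  · split_ifs <;> omega
  · have := h1 r s h hrs
    have := hne r s hrs h
    split_ifs <;> omega
  · unfold PairMem at h
    split_ifs <;> omega
  · unfold PairMem at h
    split_ifs <;> omega
  · split_ifs <;> omega

theorem exists_occZ_minimal (H : BlockGap a₁ b₁ c₁ d₁ a₂ b₂ c₂ d₂ V W i j) :
    ∃ r s : Fin n, r ≤ s ∧ OccZ V r s ∧ (s : ℕ) ≤ d₁ ∧
      ∀ r' s' : Fin n, r' ≤ s' → OccZ V r' s' → (s : ℕ) ≤ s' := by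
  classical
  obtain ⟨r, s, hrs, h, hs⟩ := H.exists_occZ_le
  have hex : ∃ m : ℕ, ∃ r s : Fin n, r ≤ s ∧ OccZ V r s ∧ (s : ℕ) = m := ⟨s, r, s, hrs, h, rfl⟩
  obtain ⟨r₀, s₀, hrs₀, h₀, hs₀⟩ := Nat.find_spec hex
  refine ⟨r₀, s₀, hrs₀, h₀, ?_, fun r' s' hrs' h' => ?_⟩
  · rw [hs₀]
    exact (Nat.find_min' hex ⟨r, s, hrs, h, rfl⟩).trans hs
  · rw [hs₀]
    exact Nat.find_min' hex ⟨r', s', hrs', h', rfl⟩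

theorem exists_occT_le (H : BlockGap a₁ b₁ c₁ d₁ a₂ b₂ c₂ d₂ V W i j) :
    ∃ k l : Fin n, k ≤ l ∧ OccT V k l ∧ (k : ℕ) ≤ b₂ := by
  by_contra! hne
  have h1 := fun r s h h' => H.occZ_spec (r := r) (s := s) h h'
  obtain ⟨h11, h12, h13, h21, h22, h23, hd, -, -, -, hij, -⟩ := id H
  refine false_of_weight H.h11 H.h12 H.h21 H.h22 H.fiber
    (fun x => if (b₂ : ℕ) < x then 1 else 0) 2 1 (fun k l hkl h => ?_) (fun r s hrs h => ?_)
    (fun k l hkl h => ?_) (fun r s hrs h => ?_) H.occ ?_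
  · have := hne k l hkl h
    rw [Fin.le_def] at hkl
    split_ifs <;> omega
  · have := h1 r s h hrs
    split_ifs <;> omega
  · split_ifs <;> omega
  · unfold PairMem at h
    split_ifs <;> omega
  · split_ifs <;> omega

theorem false_of_forall_max_lt (H : BlockGap a₁ b₁ c₁ d₁ a₂ b₂ c₂ d₂ V W i j)
    (hT : ∀ k l : Fin n, k ≤ l → OccT V k l → max (a₁ : ℕ) b₂ < l)
    (hZ : ∀ r s : Fin n, r ≤ s → OccZ V r s → (a₁ : ℕ) < s) : False := by
  have h1 := fun r s h h' => H.occZ_spec (r := r) (s := s) h h'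
  obtain ⟨h11, h12, h13, h21, h22, h23, hd, -, -, -, hij, -⟩ := id H
  refine false_of_weight H.h11 H.h12 H.h21 H.h22 H.fiber
    (fun x => if max (a₁ : ℕ) b₂ < x then 1 else 0) 1 1 (fun k l hkl h => ?_)
    (fun r s hrs h => ?_) (fun k l hkl h => ?_) (fun r s hrs h => ?_) H.occ ?_
  · have := hT k l hkl h
    split_ifs <;> omega
  · have := h1 r s h hrs
    have := hZ r s hrs h
    split_ifs <;> omega
  · unfold PairMem at h
    split_ifs <;> omega
  · unfold PairMem at h
    split_ifs <;> omega
  · split_ifs <;> omega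

theorem lt_of_minimal (H : BlockGap a₁ b₁ c₁ d₁ a₂ b₂ c₂ d₂ V W i j) {r s : Fin n} (hrs : r ≤ s)
    (h : OccZ V r s) (hmin : ∀ r' s' : Fin n, r' ≤ s' → OccZ V r' s' → (s : ℕ) ≤ s') :
    (b₁ : ℕ) < s := by
  by_contra! hsb
  obtain ⟨k₀, l₀, hkl₀, h₀, hk₀⟩ := H.exists_occT_le
  have key : ∀ k l : Fin n, k ≤ l → OccT V k l → (k : ℕ) ≤ b₂ →
      (k : ℕ) ≤ a₁ ∧ max (a₁ : ℕ) b₂ < l ∧ (l : ℕ) ≤ s := by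
    intro k l hkl hkl' hk
    have h1 := H.le_of_occT_of_occZ hkl' h hkl hrs
    have h2 := H.not_pairMem hkl' h hk hrs
    have h3 := fun hl => H.not_pairMem hkl'.symm h hl hrs
    have h4 := H.occT_spec hkl' hkl
    rw [Fin.le_def] at hkl
    unfold PairMem at *
    omega
  have h₀' := key _ _ hkl₀ h₀ hk₀
  refine H.false_of_forall_max_lt (fun k l hkl hkl' => ?_) (fun r' s' hrs' h' => ?_)
  · by_contra! hl
    have h1 := fun hk => key k l hkl hkl' hk
    have h2 := H.occT_spec hkl' hkl
    have h3 := Fin.le_def.1 hkl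
    have := H.h12
    refine H.not_exchange h₀ hkl' hkl (by omega) (by omega) ?_ ?_ <;> unfold PairMem <;> omega
  · have := hmin _ _ hrs' h'
    omega

theorem false_of_forall_not_between (H : BlockGap a₁ b₁ c₁ d₁ a₂ b₂ c₂ d₂ V W i j)
    (hZ : ∀ r s : Fin n, r ≤ s → OccZ V r s → (b₁ : ℕ) < s)
    (hT : ∀ k l : Fin n, k ≤ l → OccT V k l → (k : ℕ) ≤ b₂ → max (c₁ : ℕ) b₂ < l) : False := by
  have h1 := fun r s h h' => H.occZ_spec (r := r) (s := s) h h'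
  have h2 := fun k l h h' => H.occT_spec (k := k) (l := l) h h'
  obtain ⟨h11, h12, h13, h21, h22, h23, hd, -, -, -, hij, -⟩ := id H
  obtain ⟨k₀, l₀, hkl₀, h₀, hk₀⟩ := H.exists_occT_le
  have hl₀ := hT _ _ hkl₀ h₀ hk₀
  have hkl₀' := Fin.le_def.1 hkl₀
  have hk₀' := h2 _ _ h₀ hkl₀
  have hT' : ∀ k l : Fin n, k ≤ l → OccT V k l → max (c₁ : ℕ) b₂ < l := by
    intro k l hkl h
    by_contra! hl
    have hk := hT _ _ hkl h
    rw [Fin.le_def] at hkl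
    refine H.not_exchange h₀ h hkl (by omega) (by omega) ?_ ?_ <;> unfold PairMem <;> omega
  by_cases hdef : ∃ k l : Fin n, k ≤ l ∧ OccT V k l ∧ (k : ℕ) ≤ max (c₁ : ℕ) b₂ ∧ (l : ℕ) ≤ b₁ ∧ (a₁ : ℕ) < l
  · obtain ⟨p, q, hpq, h, hp, hqb, hqa⟩ := hdef
    have h' := h2 _ _ h hpq
    refine H.false_of_forall_max_lt (fun k l hkl hkl' => ?_) (fun r s hrs hrs' => ?_)
    · have hl := hT' _ _ hkl hkl'
      by_contra! hla
      rw [Fin.le_def] at hkl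
      refine H.irred.not_occTT H.h11 H.h12 (h.pair hkl' (by omega)) ?_ (?_ : PairMem _ _ _ _ q l) ?_ ?_ <;>
        simp only [PairMem, PairRlex] <;> omega
    · have := hZ _ _ hrs hrs'
      omega
  push Not at hdef
  refine false_of_weight_of_defect H.h11 H.h12 H.h21 H.h22 H.fiber
    (stepWeight (max (c₁ : ℕ) b₂) (max (b₁ : ℕ) b₂)) 2 2 (fun k l hkl h => ?_)
    (fun k l k' l' hkl hkl' h => ?_) (fun r s hrs h => ?_) (fun k l hkl h => ?_)
    (fun r s hrs h => ?_) H.occ ?_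
  · have := hT' _ _ hkl h
    unfold stepWeight
    split_ifs <;> omega
  · have h3 := hT' _ _ hkl h.left
    have h4 := hT' _ _ hkl' h.right
    have h5 := hdef _ _ hkl h.left
    have h6 := hdef _ _ hkl' h.right
    have h7 := h2 _ _ h.left hkl
    have h8 := h2 _ _ h.right hkl'
    have key : ¬ ((k : ℕ) ≤ max (c₁ : ℕ) b₂ ∧ (l : ℕ) ≤ b₁ ∧ (k' : ℕ) ≤ max (c₁ : ℕ) b₂ ∧ (l' : ℕ) ≤ b₁) := by
      intro hlow
      refine H.irred.not_occTT H.h11 H.h12 h ?_ ?_ ?_ ?_ <;>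
        simp only [PairMem, PairRlex] <;> omega
    rw [Fin.le_def] at hkl hkl'
    by_cases hkl1 : (k : ℕ) ≤ max (c₁ : ℕ) b₂ ∧ (l : ℕ) ≤ b₁
    · right
      unfold stepWeight
      split_ifs <;> omega
    · left
      unfold stepWeight
      split_ifs <;> omega
  · have := h1 _ _ h hrs
    have := hZ _ _ hrs h
    unfold stepWeight
    split_ifs <;> omega
  · unfold PairMem at h
    unfold stepWeight
    split_ifs <;> omega
  · unfold PairMem at h
    unfold stepWeight
    split_ifs <;> omega
  · unfold stepWeight
    split_ifs <;> omega

theorem contradiction (H : BlockGap a₁ b₁ c₁ d₁ a₂ b₂ c₂ d₂ V W i j) : False := by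
  obtain ⟨r₀, s₀, hrs₀, h₀, hs₀, hmin⟩ := H.exists_occZ_minimal
  have hs₀' := H.lt_of_minimal hrs₀ h₀ hmin
  have hZ : ∀ r s : Fin n, r ≤ s → OccZ V r s → (b₁ : ℕ) < s :=
    fun r s hrs h => hs₀'.trans_le (hmin _ _ hrs h)
  have h1 := fun r s h h' => H.occZ_spec (r := r) (s := s) h h'
  have h2 := fun k l h h' => H.occT_spec (k := k) (l := l) h h'
  obtain ⟨h11, h12, h13, h21, h22, h23, hd, -, -, -, hij, -⟩ := id H
  have hT : ∀ k l : Fin n, k ≤ l → OccT V k l →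
      ((k : ℕ) ≤ b₂ → (c₁ : ℕ) < l) ∧ ((l : ℕ) ≤ b₂ → (c₁ : ℕ) < k) := by
    intro k l hkl h
    have h3 := H.le_of_occT_of_occZ h h₀ hkl hrs₀
    have h4 := fun hk => H.not_pairMem h h₀ hk hrs₀
    have h5 := fun hl => H.not_pairMem h.symm h₀ hl hrs₀
    rw [Fin.le_def] at hkl
    unfold PairMem at h4 h5
    omega
  by_cases hA : ∃ k l : Fin n, k ≤ l ∧ OccT V k l ∧ (l : ℕ) ≤ b₂
  swap
  · push Not at hA
    refine H.false_of_forall_not_between hZ fun k l hkl h hk => ?_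
    have := hA k l hkl h
    have := hT k l hkl h
    omega
  obtain ⟨p, q, hpq, hA, hq⟩ := hA
  have hp := (hT _ _ hpq hA).2 hq
  have hA' := h2 _ _ hA hpq
  have hT' : ∀ k l : Fin n, k ≤ l → OccT V k l → (k : ℕ) ≤ c₁ → max (b₁ : ℕ) b₂ < l := by
    intro k l hkl h hk
    by_contra! hl
    have h3 := hT _ _ hkl h
    rw [Fin.le_def] at hpq
    refine H.not_exchange h hA hpq (by omega) (by omega) ?_ ?_ <;> unfold PairMem <;> omega
  by_cases hr : ∃ r s : Fin n, r ≤ s ∧ OccZ V r s ∧ (r : ℕ) ≤ c₁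
  swap
  · push Not at hr
    refine false_of_weight H.h11 H.h12 H.h21 H.h22 H.fiber
      (stepWeight c₁ (max (b₁ : ℕ) b₂)) 2 3 (fun k l hkl h => ?_) (fun r s hrs h => ?_)
      (fun k l hkl h => ?_) (fun r s hrs h => ?_) H.occ ?_
    · have h3 := hT _ _ hkl h
      have h4 := hT' _ _ hkl h
      rw [Fin.le_def] at hkl
      unfold stepWeight
      split_ifs <;> omega
    · have h3 := h1 _ _ h hrs
      have h4 := hr _ _ hrs h
      have h5 := hZ _ _ hrs h
      unfold stepWeight
      split_ifs <;> omega
    · unfold PairMem at h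
      unfold stepWeight
      split_ifs <;> omega
    · unfold PairMem at h
      unfold stepWeight
      split_ifs <;> omega
    · unfold stepWeight
      split_ifs <;> omega
  obtain ⟨r, s, hrs, hr, hs, hrc⟩ : ∃ r s : Fin n, r ≤ s ∧ OccZ V r s ∧ (s : ℕ) ≤ d₁ ∧
      (r : ℕ) ≤ c₁ := by
    obtain ⟨r, s, hrs, hr, hrc⟩ := hr
    by_cases hs : (s : ℕ) ≤ d₁
    · exact ⟨r, s, hrs, hr, hs, hrc⟩
    refine ⟨r₀, s₀, hrs₀, h₀, hs₀, ?_⟩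
    by_contra! hr₀
    have h3 := h1 _ _ h₀ hrs₀
    have h4 := h1 _ _ hr hrs
    rw [Fin.le_def] at hrs hrs₀
    refine H.irred.not_occZZ H.h21 H.h22 (hr.pair h₀.symm (by omega)) ?_ (?_ : PairMem _ _ _ _ s r₀) ?_ ?_ <;>
      simp only [PairMem, PairMrlex, PairRlex] <;> omega
  have hs' := hZ _ _ hrs hr
  have hs'' := h1 _ _ hr hrs
  have hA₂ : ∀ k l : Fin n, k ≤ l → OccT V k l → (l : ℕ) ≤ b₂ → (a₂ : ℕ) < k := by
    intro k l hkl h hl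
    by_contra! hk
    rw [Fin.le_def] at hrs hkl
    refine H.irred.not_exchange H.h11 H.h12 H.h21 H.h22 h hr (add_comm _ _) ?_ ?_ ?_ <;>
      simp only [PairMem, PairMrlex, PairRlex] <;> omega
  have hT₂ : ∀ k l : Fin n, k ≤ l → OccT V k l → (c₁ : ℕ) < k → (a₂ : ℕ) < k := by
    intro k l hkl h hk
    by_contra! hk'
    have h3 := hA₂ _ _ hkl h
    have h4 := hA₂ _ _ hpq hA hq
    have h5 := h2 _ _ h hkl
    rw [Fin.le_def] at hpq
    refine H.not_exchange h hA hpq (by omega) (by omega) ?_ ?_ <;> unfold PairMem <;> omega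
  refine false_of_weight H.h11 H.h12 H.h21 H.h22 H.fiber
    (stepWeight (max (a₂ : ℕ) c₁) (max (b₁ : ℕ) b₂)) 2 2 (fun k l hkl h => ?_) (fun r s hrs h => ?_)
    (fun k l hkl h => ?_) (fun r s hrs h => ?_) H.occ ?_
  · have h4 := hT' _ _ hkl h
    have h5 := hT₂ _ _ hkl h
    rw [Fin.le_def] at hkl
    unfold stepWeight
    split_ifs <;> omega
  · have h3 := h1 _ _ h hrs
    have h5 := hZ _ _ hrs h
    unfold stepWeight
    split_ifs <;> omega
  · unfold PairMem at h
    unfold stepWeight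
    split_ifs <;> omega
  · unfold PairMem at h
    unfold stepWeight
    split_ifs <;> omega
  · have := H.occ.pairMem H.h21 H.h22
    unfold PairMem at this
    unfold stepWeight
    split_ifs <;> omega

end BlockGap

section

variable {n : ℕ} {a₁ b₁ c₁ d₁ a₂ b₂ c₂ d₂ : Fin n}
  {V W : ↥(BM a₁ b₁ ∪ BN b₁ c₁ d₁) ⊕ ↥(BM a₂ b₂ ∪ BN b₂ c₂ d₂) →₀ ℕ}

/-- No variable of a monomial in the fiber of an irreducible `V` is smaller than all variables
of `V`. -/
theorem IsIrred.not_forall_hTVarGt (hV : IsIrred (GHT a₁ b₁ c₁ d₁ a₂ b₂ c₂ d₂) V)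
    (h11 : c₁ < a₁) (h12 : a₁ ≤ b₁) (h13 : b₁ < d₁)
    (h21 : c₂ < a₂) (h22 : a₂ ≤ b₂) (h23 : b₂ < d₂) (hd : d₁ ≤ d₂)
    (h : fiberMap (TZexp _ _) V = fiberMap (TZexp _ _) W)
    {w : ↥(BM a₁ b₁ ∪ BN b₁ c₁ d₁) ⊕ ↥(BM a₂ b₂ ∪ BN b₂ c₂ d₂)} (hw : W w ≠ 0) :
    ¬ ∀ v, V v ≠ 0 → HTVarGt a₂ b₂ c₂ d₂ _ _ v w := by
  intro hall
  rcases w with w | w <;> obtain ⟨i, j, hij⟩ := exists_eq_quad w.2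
  · refine hV.false_of_occT h11 h12 h ⟨w, hij, hw⟩ ?_ ?_
    · rintro k l ⟨u, hu, huV⟩
      have := hall _ huV
      simp only [HTVarGt, hu, hij] at this
      exact rlexGt_quad_iff.1 this
    · rintro r s ⟨u, hu, huV⟩
      exact hall _ huV
  · have hW : OccZ W i j := ⟨w, hij, hw⟩
    have hZ : ∀ r s : Fin n, OccZ V r s → PairMrlex b₂ r s i j := by
      rintro r s hrs
      have hrs' := hrs.pairMem h21 h22
      obtain ⟨u, hu, huV⟩ := hrs
      have := hall _ huV
      simp only [HTVarGt, hu, hij] at this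
      exact (mrlexGt_quad_iff h21 h22 hrs' (hW.pairMem h21 h22)).1 this
    by_cases hiff : ∃ r s : Fin n, OccZ V r s ∧
        ((b₂ : ℕ) < max (r : ℕ) s ↔ (b₂ : ℕ) < max (i : ℕ) j)
    · obtain ⟨r, s, hrs, hiff⟩ := hiff
      exact hV.false_of_occZ_of_iff h11 h12 h21 h22 h hW hZ hrs hiff
    · push Not at hiff
      have hlt : ∀ r s : Fin n, OccZ V r s →
          (b₂ : ℕ) < max (r : ℕ) s ∧ max (i : ℕ) j ≤ b₂ := by
        intro r s hrs
        have h1 := hiff r s hrs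
        have h2 := hZ r s hrs
        unfold PairMrlex at h2
        omega
      obtain ⟨r, s, hrs⟩ := exists_occZ_of_fiberMap_eq h hW
      exact BlockGap.contradiction ⟨h11, h12, h13, h21, h22, h23, hd, hV, h, hW,
        (hlt r s hrs).2, fun r s hrs => (hlt r s hrs).1⟩

theorem eq_of_isIrred (h11 : c₁ < a₁) (h12 : a₁ ≤ b₁) (h13 : b₁ < d₁)
    (h21 : c₂ < a₂) (h22 : a₂ ≤ b₂) (h23 : b₂ < d₂) (hd : d₁ ≤ d₂)
    (hV : IsIrred (GHT a₁ b₁ c₁ d₁ a₂ b₂ c₂ d₂) V) (hW : IsIrred (GHT a₁ b₁ c₁ d₁ a₂ b₂ c₂ d₂) W)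
    (h : fiberMap (TZexp _ _) V = fiberMap (TZexp _ _) W) : V = W := by
  induction hN : V.degree + W.degree using Nat.strong_induction_on generalizing V W with
  | _ N ih =>
  subst hN
  classical
  rcases (V.support ∪ W.support).eq_empty_or_nonempty with he | hne
  · rw [Finset.union_eq_empty, Finsupp.support_eq_empty, Finsupp.support_eq_empty] at he
    rw [he.1, he.2]
  obtain ⟨w, hw, hmax⟩ := Finset.exists_max_image _ (tzRank b₂ c₂ d₂ _ _) hne
  have hgt : ∀ v, (V v ≠ 0 ∨ W v ≠ 0) → v ≠ w → HTVarGt a₂ b₂ c₂ d₂ _ _ v w := by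
    intro v hv hvw
    refine (HTVarGt_or h21 h22 hvw).resolve_right fun hlt => ?_
    refine (tzRank_lt h21 h22 hlt).not_ge (hmax v ?_)
    simpa [Finset.mem_union] using hv
  have hVw : V w ≠ 0 := by
    intro hVw
    refine hV.not_forall_hTVarGt h11 h12 h13 h21 h22 h23 hd h (w := w) ?_ fun v hv =>
      hgt v (.inl hv) ?_
    · simpa [hVw] using hw
    · rintro rfl
      exact hv hVw
  have hWw : W w ≠ 0 := by
    intro hWw
    refine hW.not_forall_hTVarGt h11 h12 h13 h21 h22 h23 hd h.symm (w := w) hVw fun v hv =>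
      hgt v (.inr hv) ?_
    rintro rfl
    exact hv hWw
  obtain ⟨V', rfl⟩ := exists_eq_single_add hVw
  obtain ⟨W', rfl⟩ := exists_eq_single_add hWw
  rw [fiberMap_add, fiberMap_add, add_right_inj] at h
  rw [ih _ ?_ (hV.mono le_add_self) (hW.mono le_add_self) h rfl]
  simp only [map_add, Finsupp.degree_single]
  omega

end

/-- For strongly stable ideals `I₁ = B(x_{a₁}x_{b₁}, x_{c₁}x_{d₁})` and
`I₂ = B(x_{a₂}x_{b₂}, x_{c₂}x_{d₂})` with `cᵢ < aᵢ ≤ bᵢ < dᵢ` and `d₁ ≤ d₂`, and the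
marked collection `G = G₁ ∪ G₂ ∪ G₃`, every fiber graph `Γ_μ(I₁, I₂)` with respect to
`G` (over multidegrees `μ` in `K[x_1, …, x_n, t, z]`) is either empty or has a unique
sink. -/
theorem twoIdeals_fiberGraph_unique_sink {n : ℕ}
    (a₁ b₁ c₁ d₁ a₂ b₂ c₂ d₂ : Fin n)
    (h11 : c₁ < a₁) (h12 : a₁ ≤ b₁) (h13 : b₁ < d₁)
    (h21 : c₂ < a₂) (h22 : a₂ ≤ b₂) (h23 : b₂ < d₂) (hd : d₁ ≤ d₂) :
    ∀ μ : (Fin n ⊕ Fin 2) →₀ ℕ,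
      (∀ V : (↥(BM a₁ b₁ ∪ BN b₁ c₁ d₁) ⊕ ↥(BM a₂ b₂ ∪ BN b₂ c₂ d₂)) →₀ ℕ,
        fiberMap (TZexp (BM a₁ b₁ ∪ BN b₁ c₁ d₁) (BM a₂ b₂ ∪ BN b₂ c₂ d₂)) V ≠ μ) ∨
      (∃! V : (↥(BM a₁ b₁ ∪ BN b₁ c₁ d₁) ⊕ ↥(BM a₂ b₂ ∪ BN b₂ c₂ d₂)) →₀ ℕ,
        IsFiberSink (GHT a₁ b₁ c₁ d₁ a₂ b₂ c₂ d₂)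
          (TZexp (BM a₁ b₁ ∪ BN b₁ c₁ d₁) (BM a₂ b₂ ∪ BN b₂ c₂ d₂)) μ V) := by
  intro μ
  have hsink := fun T => isFiberSink_iff (μ := μ) (T := T)
    (fun g (hg : g ∈ GHT a₁ b₁ c₁ d₁ a₂ b₂ c₂ d₂) => fiberMap_head_eq_tail hg)
  rw [or_iff_not_imp_left]
  intro hne
  push Not at hne
  obtain ⟨T, hT⟩ := hne
  obtain ⟨V, hVT, hV⟩ := exists_isIrred_GHT h21 h22 T
  refine ⟨V, (hsink V).2 ⟨hVT.trans hT, hV⟩, fun W hW => ?_⟩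
  obtain ⟨hWμ, hW⟩ := (hsink W).1 hW
  exact eq_of_isIrred h11 h12 h13 h21 h22 h23 hd hW hV (hWμ.trans (hVT.trans hT).symm)
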